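/- arXiv:1701.05816 — 11 statements merged into one kernel-verified Lean document; each statement's English description precedes it below -/
import Mathlib

section
/- Let U ⊆ ℝ be an open set and let f₁, f₂ : U → U be real-analytic maps having a common fixed point p ∈ U which is locally asymptotically stable (LAS) for both f₁ and f₂. Then p is either LAS or semi-asymptotically stable (semi-AS, i.e. semi-AS from the left or from the right) for the composition map f₂ ∘ f₁. -/
open Filter Topology

/-- `p` is a locally asymptotically stable (LAS) fixed point of `f`. -/
def IsLAS (f : ℝ → ℝ) (p : ℝ) : Prop :=
  (∀ ε > 0, ∃ δ > 0, ∀ x : ℝ, |x - p| < δ → ∀ n : ℕ, 1 ≤ n → |f^[n] x - p| < ε) ∧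
  (∃ η > 0, ∀ x : ℝ, |x - p| < η → Tendsto (fun n => f^[n] x) atTop (𝓝 p))

/-- `p` is a repeller fixed point of `f`. -/
def IsRepeller (f : ℝ → ℝ) (p : ℝ) : Prop :=
  ∃ ε₀ > 0, ∀ ε : ℝ, 0 < ε → ε < ε₀ → ∀ x : ℝ, x ≠ p → |x - p| < ε →
    ∃ n : ℕ, |f^[n] x - p| > ε

/-- `p` is semi-asymptotically stable from the left for `f`. -/
def IsSemiASLeft (f : ℝ → ℝ) (p : ℝ) : Prop :=
  (∀ ε > 0, ∃ δ > 0, ∀ x ∈ Set.Ioo (p - δ) p, ∀ n : ℕ, 1 ≤ n → |f^[n] x - p| < ε) ∧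
  (∃ η > 0, ∀ x ∈ Set.Ioo (p - η) p, Tendsto (fun n => f^[n] x) atTop (𝓝 p)) ∧
  (∃ η > 0, ∀ x ∈ Set.Ioo p (p + η), ∃ n : ℕ, |f^[n] x - p| > η)

/-- `p` is semi-asymptotically stable from the right for `f`. -/
def IsSemiASRight (f : ℝ → ℝ) (p : ℝ) : Prop :=
  (∀ ε > 0, ∃ δ > 0, ∀ x ∈ Set.Ioo p (p + δ), ∀ n : ℕ, 1 ≤ n → |f^[n] x - p| < ε) ∧
  (∃ η > 0, ∀ x ∈ Set.Ioo p (p + η), Tendsto (fun n => f^[n] x) atTop (𝓝 p)) ∧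
  (∃ η > 0, ∀ x ∈ Set.Ioo (p - η) p, ∃ n : ℕ, |f^[n] x - p| > η)

/-- `p` is semi-asymptotically stable (from the left or from the right) for `f`. -/
def IsSemiAS (f : ℝ → ℝ) (p : ℝ) : Prop := IsSemiASLeft f p ∨ IsSemiASRight f p

/-- If the orbit of `x` stays in a closed subset of a closed ball on which `f` is continuous and the
distances to `p` converge, then they converge to the distance of a point which `f` maps to a point
at the same distance from `p`. -/
lemma exists_dist_eq_of_tendsto {f : ℝ → ℝ} {p η d x : ℝ} {S : Set ℝ} (hS : IsClosed S)
    (hc : ∀ y, |y - p| ≤ η → ContinuousAt f y)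
    (hx : ∀ n, f^[n] x ∈ S ∧ |f^[n] x - p| ≤ η)
    (hd : Tendsto (fun n => |f^[n] x - p|) atTop (𝓝 d)) :
    ∃ y ∈ S, |y - p| ≤ η ∧ |y - p| = d ∧ |f y - p| = d := by
  have hK : IsCompact (Metric.closedBall p η ∩ S) := (isCompact_closedBall p η).inter_right hS
  obtain ⟨y, ⟨hyη, hyS⟩, φ, hφ, hlim⟩ := hK.tendsto_subseq (x := fun n => f^[n] x)
    fun n => ⟨by simpa [Real.dist_eq] using (hx n).2, (hx n).1⟩
  have hyη : |y - p| ≤ η := by simpa [Real.dist_eq] using hyη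
  refine ⟨y, hyS, hyη, ?_, ?_⟩
  · exact tendsto_nhds_unique (hlim.sub_const p).abs (hd.comp hφ.tendsto_atTop)
  · have h₁ := (((hc y hyη).tendsto.comp hlim).sub_const p).abs
    have h₂ := hd.comp ((tendsto_add_atTop_nat 1).comp hφ.tendsto_atTop)
    refine tendsto_nhds_unique h₁ (h₂.congr fun n => ?_)
    simp [Function.iterate_succ_apply']

/-- A map strictly decreasing the distance to `p` on a closed set `S` attracts points of `S`. -/
lemma exists_attracting_radius {f : ℝ → ℝ} {p : ℝ} {S : Set ℝ} (hS : IsClosed S) (hpS : p ∈ S)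
    (hfix : f p = p) (hc : ∀ᶠ x in 𝓝 p, ContinuousAt f x)
    (hf : ∀ᶠ x in 𝓝 p, x ∈ S → x ≠ p → f x ∈ S ∧ |f x - p| < |x - p|) :
    ∃ r > 0, ∀ x ∈ S, |x - p| < r →
      (∀ n, |f^[n] x - p| ≤ |x - p|) ∧ Tendsto (fun n => f^[n] x) atTop (𝓝 p) := by
  obtain ⟨r, hr, h⟩ := Metric.eventually_nhds_iff.1 (hc.and hf)
  simp only [Real.dist_eq] at h
  refine ⟨r, hr, fun x hxS hx => ?_⟩
  have step : ∀ y ∈ S, |y - p| ≤ |x - p| → f y ∈ S ∧ |f y - p| ≤ |y - p| := by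
    intro y hy hyx
    by_cases hyp : y = p
    · subst hyp; simp [hfix, hpS]
    · have := (h (hyx.trans_lt hx)).2 hy hyp
      exact ⟨this.1, this.2.le⟩
  have orbit : ∀ n, f^[n] x ∈ S ∧ |f^[n] x - p| ≤ |x - p| := by
    intro n
    induction n with
    | zero => simpa using hxS
    | succ n ih =>
      rw [Function.iterate_succ_apply']
      have := step _ ih.1 ih.2
      exact ⟨this.1, this.2.trans ih.2⟩
  refine ⟨fun n => (orbit n).2, ?_⟩
  have anti : Antitone fun n => |f^[n] x - p| := antitone_nat_of_succ_le fun n => by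
    rw [Function.iterate_succ_apply']
    exact (step _ (orbit n).1 (orbit n).2).2
  have hd := tendsto_atTop_ciInf anti ⟨0, by rintro _ ⟨n, rfl⟩; exact abs_nonneg _⟩
  obtain ⟨y, hyS, hyx, hyd, hfy⟩ := exists_dist_eq_of_tendsto hS
    (fun y hy => (h (hy.trans_lt hx)).1) orbit hd
  have hyp : y = p := by
    by_contra hyp
    have := ((h (hyx.trans_lt hx)).2 hyS hyp).2
    linarith
  rw [← hyd, hyp, sub_self, abs_zero] at hd
  exact tendsto_iff_dist_tendsto_zero.2 (by simpa only [Real.dist_eq] using hd)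

/-- A map strictly increasing the distance to `p` on a closed set `S` expels points of `S`. -/
lemma exists_escape_radius {f : ℝ → ℝ} {p : ℝ} {S : Set ℝ} (hS : IsClosed S)
    (hc : ∀ᶠ x in 𝓝 p, ContinuousAt f x)
    (hf : ∀ᶠ x in 𝓝 p, x ∈ S → x ≠ p → f x ∈ S ∧ |x - p| < |f x - p|) :
    ∃ η > 0, ∀ x ∈ S, x ≠ p → ∃ n : ℕ, |f^[n] x - p| > η := by
  obtain ⟨r, hr, h⟩ := Metric.eventually_nhds_iff.1 (hc.and hf)
  simp only [Real.dist_eq] at h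
  refine ⟨r / 2, half_pos hr, fun x hxS hxp => ?_⟩
  by_contra! hle
  have hlt : ∀ y, |y - p| ≤ r / 2 → |y - p| < r := fun y hy => by linarith
  have hpos : 0 < |x - p| := abs_pos.2 (sub_ne_zero.2 hxp)
  have orbit : ∀ n, f^[n] x ∈ S ∧ |x - p| ≤ |f^[n] x - p| := by
    intro n
    induction n with
    | zero => simpa using hxS
    | succ n ih =>
      rw [Function.iterate_succ_apply']
      have := (h (hlt _ (hle n))).2 ih.1 (sub_ne_zero.1 (abs_pos.1 (hpos.trans_le ih.2)))
      exact ⟨this.1, ih.2.trans this.2.le⟩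
  have mono : Monotone fun n => |f^[n] x - p| := monotone_nat_of_le_succ fun n => by
    rw [Function.iterate_succ_apply']
    exact ((h (hlt _ (hle n))).2 (orbit n).1
      (sub_ne_zero.1 (abs_pos.1 (hpos.trans_le (orbit n).2)))).2.le
  have hd := tendsto_atTop_ciSup mono ⟨r / 2, by rintro _ ⟨n, rfl⟩; exact hle n⟩
  obtain ⟨y, hyS, hyη, hyd, hfy⟩ := exists_dist_eq_of_tendsto hS
    (fun y hy => (h (hlt y hy)).1) (fun n => ⟨(orbit n).1, hle n⟩) hd
  have hge : |x - p| ≤ |y - p| := hyd ▸ ge_of_tendsto' hd fun n => (orbit n).2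
  have := ((h (hlt y hyη)).2 hyS (sub_ne_zero.1 (abs_pos.1 (hpos.trans_le hge)))).2
  linarith

lemma isLAS_of_eventually_abs_lt {f : ℝ → ℝ} {p : ℝ} (hfix : f p = p)
    (hc : ∀ᶠ x in 𝓝 p, ContinuousAt f x)
    (hf : ∀ᶠ x in 𝓝 p, x ≠ p → |f x - p| < |x - p|) : IsLAS f p := by
  obtain ⟨r, hr, h⟩ := exists_attracting_radius isClosed_univ (Set.mem_univ p) hfix hc
    (hf.mono fun x hx _ hxp => ⟨Set.mem_univ _, hx hxp⟩)
  refine ⟨fun ε hε => ⟨min r ε, lt_min hr hε, fun x hx n _ => ?_⟩, r, hr, fun x hx =>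
    (h x (Set.mem_univ x) hx).2⟩
  exact ((h x (Set.mem_univ x) (hx.trans_le (min_le_left _ _))).1 n).trans_lt
    (hx.trans_le (min_le_right _ _))

lemma isSemiASRight_of_eventually {f : ℝ → ℝ} {p : ℝ} (hfix : f p = p)
    (hc : ∀ᶠ x in 𝓝 p, ContinuousAt f x)
    (hr : ∀ᶠ x in 𝓝 p, p < x → p < f x ∧ f x < x)
    (hl : ∀ᶠ x in 𝓝 p, x < p → f x < x) : IsSemiASRight f p := by
  obtain ⟨r, hr0, h⟩ := exists_attracting_radius isClosed_Ici (Set.mem_Ici.2 le_rfl) hfix hc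
    (hr.mono fun x hx hxS hxp => by
      obtain ⟨h₁, h₂⟩ := hx (lt_of_le_of_ne hxS hxp.symm)
      refine ⟨h₁.le, ?_⟩
      rw [abs_of_pos (by linarith), abs_of_pos (by linarith)]
      linarith)
  obtain ⟨η, hη, h'⟩ := exists_escape_radius (isClosed_Iic (a := p)) hc
    (hl.mono fun x hx hxS hxp => by
      have h₁ := lt_of_le_of_ne hxS hxp
      have h₂ := hx h₁
      refine ⟨(h₂.trans h₁).le, ?_⟩
      rw [abs_of_neg (by linarith), abs_of_neg (by linarith)]
      linarith)
  have habs : ∀ δ, ∀ x ∈ Set.Ioo p (p + δ), |x - p| < δ := fun δ x hx => by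
    rw [abs_of_pos (by linarith [hx.1])]
    linarith [hx.2]
  refine ⟨fun ε hε => ⟨min r ε, lt_min hr0 hε, fun x hx n _ => ?_⟩,
    ⟨r, hr0, fun x hx => (h x hx.1.le (habs r x hx)).2⟩,
    ⟨η, hη, fun x hx => h' x hx.2.le hx.2.ne⟩⟩
  exact ((h x hx.1.le ((habs _ x hx).trans_le (min_le_left _ _))).1 n).trans_lt
    ((habs _ x hx).trans_le (min_le_right _ _))

lemma isSemiASLeft_of_eventually {f : ℝ → ℝ} {p : ℝ} (hfix : f p = p)
    (hc : ∀ᶠ x in 𝓝 p, ContinuousAt f x)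
    (hl : ∀ᶠ x in 𝓝 p, x < p → x < f x ∧ f x < p)
    (hr : ∀ᶠ x in 𝓝 p, p < x → x < f x) : IsSemiASLeft f p := by
  obtain ⟨r, hr0, h⟩ := exists_attracting_radius isClosed_Iic (Set.mem_Iic.2 le_rfl) hfix hc
    (hl.mono fun x hx hxS hxp => by
      obtain ⟨h₁, h₂⟩ := hx (lt_of_le_of_ne hxS hxp)
      refine ⟨h₂.le, ?_⟩
      rw [abs_of_neg (by linarith), abs_of_neg (by linarith)]
      linarith)
  obtain ⟨η, hη, h'⟩ := exists_escape_radius (isClosed_Ici (a := p)) hc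
    (hr.mono fun x hx hxS hxp => by
      have h₁ := lt_of_le_of_ne hxS hxp.symm
      have h₂ := hx h₁
      refine ⟨(h₁.trans h₂).le, ?_⟩
      rw [abs_of_pos (by linarith), abs_of_pos (by linarith)]
      linarith)
  have habs : ∀ δ, ∀ x ∈ Set.Ioo (p - δ) p, |x - p| < δ := fun δ x hx => by
    rw [abs_of_neg (by linarith [hx.2])]
    linarith [hx.1]
  refine ⟨fun ε hε => ⟨min r ε, lt_min hr0 hε, fun x hx n _ => ?_⟩,
    ⟨r, hr0, fun x hx => (h x hx.2.le (habs r x hx)).2⟩,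
    ⟨η, hη, fun x hx => h' x hx.1.le hx.1.ne'⟩⟩
  exact ((h x hx.2.le ((habs _ x hx).trans_le (min_le_left _ _))).1 n).trans_lt
    ((habs _ x hx).trans_le (min_le_right _ _))

lemma iterate_comp_self (f : ℝ → ℝ) (n : ℕ) : (f ∘ f)^[n] = f^[2 * n] :=
  (Function.iterate_mul f 2 n).symm

lemma IsLAS.comp_self {f : ℝ → ℝ} {p : ℝ} (h : IsLAS f p) : IsLAS (f ∘ f) p := by
  obtain ⟨hs, η, hη, ht⟩ := h
  refine ⟨fun ε hε => ?_, η, hη, fun x hx => ?_⟩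
  · obtain ⟨δ, hδ, h⟩ := hs ε hε
    refine ⟨δ, hδ, fun x hx n hn => ?_⟩
    rw [iterate_comp_self]
    exact h x hx _ (by omega)
  · simp only [iterate_comp_self]
    exact (ht x hx).comp (tendsto_id.const_mul_atTop' two_pos)

lemma IsLAS.of_comp_self {f : ℝ → ℝ} {p : ℝ} (hfix : f p = p) (hc : ContinuousAt f p)
    (h : IsLAS (f ∘ f) p) : IsLAS f p := by
  obtain ⟨hs, η, hη, ht⟩ := h
  have near : ∀ ε > 0, ∃ δ > 0, ∀ x, |x - p| < δ → |f x - p| < ε := fun ε hε => by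
    simpa [Real.dist_eq, hfix] using Metric.continuousAt_iff.1 hc ε hε
  refine ⟨fun ε hε => ?_, η, hη, fun x hx => ?_⟩
  · obtain ⟨ε', hε', hcε⟩ := near ε hε
    obtain ⟨δ, hδ, h⟩ := hs (min ε ε') (lt_min hε hε')
    refine ⟨min δ ε', lt_min hδ hε', fun x hx n hn => ?_⟩
    have key : ∀ k, 1 ≤ k → |f^[2 * k] x - p| < min ε ε' := fun k hk => by
      rw [← iterate_comp_self]
      exact h x (hx.trans_le (min_le_left _ _)) k hk
    obtain ⟨k, rfl | rfl⟩ := Nat.even_or_odd' n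
    · exact (key k (by omega)).trans_le (min_le_left _ _)
    · rw [Function.iterate_succ_apply']
      apply hcε
      rcases Nat.eq_zero_or_pos k with rfl | hk
      · exact hx.trans_le (min_le_right _ _)
      · exact (key k hk).trans_le (min_le_right _ _)
  · have heven : Tendsto (fun n => f^[2 * n] x) atTop (𝓝 p) := by
      simpa only [iterate_comp_self] using ht x hx
    have hodd : Tendsto (fun n => f^[2 * n + 1] x) atTop (𝓝 p) := by
      have := hc.tendsto.comp heven
      rw [hfix] at this
      exact this.congr fun n => (Function.iterate_succ_apply' f _ x).symm
    rw [Metric.tendsto_atTop] at heven hodd ⊢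
    intro ε hε
    obtain ⟨N₁, h₁⟩ := heven ε hε
    obtain ⟨N₂, h₂⟩ := hodd ε hε
    refine ⟨2 * (N₁ + N₂), fun n hn => ?_⟩
    obtain ⟨k, rfl | rfl⟩ := Nat.even_or_odd' n
    · exact h₁ k (by omega)
    · exact h₂ k (by omega)

/-- Near a LAS fixed point, points of an invariant set cannot all move weakly away from it. -/
lemma IsLAS.not_eventually_abs_le {f : ℝ → ℝ} {p : ℝ} (h : IsLAS f p) {S : Set ℝ}
    (hS : ∃ᶠ x in 𝓝 p, x ∈ S ∧ x ≠ p) :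
    ¬ ∀ᶠ x in 𝓝 p, x ∈ S → f x ∈ S ∧ |x - p| ≤ |f x - p| := by
  intro hf
  obtain ⟨r, hr, hf⟩ := Metric.eventually_nhds_iff.1 hf
  simp only [Real.dist_eq] at hf
  obtain ⟨hs, η, hη, ht⟩ := h
  obtain ⟨δ, hδ, hs⟩ := hs r hr
  have hball : ∀ᶠ x in 𝓝 p, |x - p| < min r (min δ η) :=
    Metric.ball_mem_nhds p (lt_min hr (lt_min hδ hη))
  obtain ⟨x, ⟨hxS, hxp⟩, hx⟩ := (hS.and_eventually hball).exists
  simp only [lt_min_iff] at hx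
  have hnear : ∀ n, |f^[n] x - p| < r := by
    rintro (_ | n)
    · exact hx.1
    · exact hs x hx.2.1 _ (by omega)
  have orbit : ∀ n, f^[n] x ∈ S ∧ |x - p| ≤ |f^[n] x - p| := by
    intro n
    induction n with
    | zero => simpa using hxS
    | succ n ih =>
      rw [Function.iterate_succ_apply']
      have := hf (hnear n) ih.1
      exact ⟨this.1, ih.2.trans this.2⟩
  have hlim := ((ht x hx.2.2).sub_const p).abs
  rw [sub_self, abs_zero] at hlim
  exact (abs_pos.2 (sub_ne_zero.2 hxp)).not_ge (ge_of_tendsto' hlim fun n => (orbit n).2)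

lemma forall_neg_or_forall_pos_of_ne_zero {h : ℝ → ℝ} {s : Set ℝ} (hs : IsPreconnected s)
    (hc : ContinuousOn h s) (h0 : ∀ x ∈ s, h x ≠ 0) :
    (∀ x ∈ s, h x < 0) ∨ ∀ x ∈ s, 0 < h x := by
  by_contra! hcon
  obtain ⟨⟨a, ha, ha0⟩, b, hb, hb0⟩ := hcon
  obtain ⟨c, hc, hc0⟩ := hs.intermediate_value hb ha hc ⟨hb0, ha0⟩
  exact h0 c hc hc0

/-- An analytic function vanishes near `p` or has a strict constant sign on each side of `p`. -/
lemma AnalyticAt.eventually_eq_zero_or_sign {h : ℝ → ℝ} {p : ℝ} (hh : AnalyticAt ℝ h p) :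
    (∀ᶠ x in 𝓝 p, h x = 0) ∨
      ((∀ᶠ x in 𝓝 p, p < x → h x < 0) ∨ ∀ᶠ x in 𝓝 p, p < x → 0 < h x) ∧
      ((∀ᶠ x in 𝓝 p, x < p → h x < 0) ∨ ∀ᶠ x in 𝓝 p, x < p → 0 < h x) := by
  refine hh.eventually_eq_zero_or_eventually_ne_zero.imp id fun hne => ?_
  rw [eventually_nhdsWithin_iff] at hne
  have hc := hh.eventually_analyticAt.mono fun x hx => hx.continuousAt
  obtain ⟨r, hr, hr'⟩ := Metric.eventually_nhds_iff.1 (hc.and hne)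
  simp only [Real.dist_eq, abs_lt] at hr'
  constructor
  · refine (forall_neg_or_forall_pos_of_ne_zero (isPreconnected_Ioo (a := p) (b := p + r))
      (h := h) (fun x hx => ?_) (fun x hx => ?_)).imp ?_ ?_
    · exact (hr' ⟨by linarith [hx.1], by linarith [hx.2]⟩).1.continuousWithinAt
    · exact (hr' ⟨by linarith [hx.1], by linarith [hx.2]⟩).2 hx.1.ne'
    all_goals
      intro H
      filter_upwards [Iio_mem_nhds (show p < p + r by linarith)] with x hx hxp
      exact H x ⟨hxp, hx⟩
  · refine (forall_neg_or_forall_pos_of_ne_zero (isPreconnected_Ioo (a := p - r) (b := p))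
      (h := h) (fun x hx => ?_) (fun x hx => ?_)).imp ?_ ?_
    · exact (hr' ⟨by linarith [hx.1], by linarith [hx.2]⟩).1.continuousWithinAt
    · exact (hr' ⟨by linarith [hx.1], by linarith [hx.2]⟩).2 hx.2.ne
    all_goals
      intro H
      filter_upwards [Ioi_mem_nhds (show p - r < p by linarith)] with x hx hxp
      exact H x ⟨hx, hxp⟩

lemma AnalyticAt.eventually_lt_of_deriv_pos {f : ℝ → ℝ} {p : ℝ} (hf : AnalyticAt ℝ f p)
    (hd : 0 < deriv f p) : ∀ᶠ q in 𝓝 p ×ˢ 𝓝 p, q.1 < q.2 → f q.1 < f q.2 := by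
  have hc := hf.eventually_analyticAt.mono fun x hx => hx.continuousAt
  obtain ⟨r, hr, h⟩ := Metric.eventually_nhds_iff_ball.1
    (hc.and (hf.deriv.continuousAt.eventually (lt_mem_nhds hd)))
  have hmono : StrictMonoOn f (Metric.ball p r) :=
    strictMonoOn_of_deriv_pos (convex_ball p r) (fun x hx => (h x hx).1.continuousWithinAt)
      fun x hx => (h x (interior_subset hx)).2
  have hb := Metric.ball_mem_nhds p hr
  filter_upwards [prod_mem_prod hb hb] with q hq
  exact hmono hq.1 hq.2

lemma AnalyticAt.eventually_gt_of_deriv_neg {f : ℝ → ℝ} {p : ℝ} (hf : AnalyticAt ℝ f p)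
    (hd : deriv f p < 0) : ∀ᶠ q in 𝓝 p ×ˢ 𝓝 p, q.1 < q.2 → f q.2 < f q.1 := by
  have := hf.neg.eventually_lt_of_deriv_pos (by simpa [deriv.neg] using hd)
  simpa using this

/-- An analytic map with positive derivative attracts both sides of a LAS fixed point. -/
lemma IsLAS.eventually_between {f : ℝ → ℝ} {p : ℝ} (h : IsLAS f p) (hf : AnalyticAt ℝ f p)
    (hd : 0 < deriv f p) (hfix : f p = p) :
    ∀ᶠ x in 𝓝 p, (p < x → p < f x ∧ f x < x) ∧ (x < p → x < f x ∧ f x < p) := by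
  have hmr := (tendsto_const_nhds.prodMk tendsto_id).eventually (hf.eventually_lt_of_deriv_pos hd)
  have hml := (tendsto_id.prodMk tendsto_const_nhds).eventually (hf.eventually_lt_of_deriv_pos hd)
  simp only [id, hfix] at hmr hml
  have hright : ∃ᶠ x in 𝓝 p, x ∈ Set.Ioi p ∧ x ≠ p :=
    (frequently_gt_nhds p).mono fun x hx => ⟨hx, hx.ne'⟩
  have hleft : ∃ᶠ x in 𝓝 p, x ∈ Set.Iio p ∧ x ≠ p :=
    (frequently_lt_nhds p).mono fun x hx => ⟨hx, hx.ne⟩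
  have nr : ¬ ∀ᶠ x in 𝓝 p, p < x → x ≤ f x := fun H =>
    h.not_eventually_abs_le hright <| H.mono fun x hx hxp => by
      have hxp : p < x := hxp
      have := hx hxp
      refine ⟨hxp.trans_le this, ?_⟩
      rw [abs_of_pos (by linarith), abs_of_pos (by linarith)]
      linarith
  have nl : ¬ ∀ᶠ x in 𝓝 p, x < p → f x ≤ x := fun H =>
    h.not_eventually_abs_le hleft <| H.mono fun x hx hxp => by
      have hxp : x < p := hxp
      have := hx hxp
      refine ⟨this.trans_lt hxp, ?_⟩
      rw [abs_of_neg (by linarith), abs_of_neg (by linarith)]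
      linarith
  rcases (hf.sub analyticAt_id).eventually_eq_zero_or_sign with h0 | ⟨hr | hr, hl | hl⟩
  · exact (nr (h0.mono fun x hx _ => (sub_eq_zero.1 hx).ge)).elim
  · exact absurd (hl.mono fun x hx hxp => (sub_neg.1 (hx hxp)).le) nl
  · filter_upwards [hmr, hml, hr, hl] with x h₁ h₂ h₃ h₄
    exact ⟨fun hx => ⟨h₁ hx, sub_neg.1 (h₃ hx)⟩, fun hx => ⟨sub_pos.1 (h₄ hx), h₂ hx⟩⟩
  all_goals exact absurd (hr.mono fun x hx hxp => (sub_pos.1 (hx hxp)).le) nr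

lemma isLAS_of_eventually_between {f : ℝ → ℝ} {p : ℝ} (hfix : f p = p)
    (hc : ∀ᶠ x in 𝓝 p, ContinuousAt f x)
    (hf : ∀ᶠ x in 𝓝 p, (p < x → p < f x ∧ f x < x) ∧ (x < p → x < f x ∧ f x < p)) :
    IsLAS f p := by
  refine isLAS_of_eventually_abs_lt hfix hc (hf.mono fun x hx hxp => ?_)
  rcases hxp.lt_or_gt with h | h
  · have := hx.2 h
    rw [abs_of_neg (by linarith), abs_of_neg (by linarith)]
    linarith
  · have := hx.1 h
    rw [abs_of_pos (by linarith), abs_of_pos (by linarith)]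
    linarith

lemma isLAS_of_deriv_eq_zero {f : ℝ → ℝ} {p : ℝ} (hf : AnalyticAt ℝ f p) (hfix : f p = p)
    (hd : deriv f p = 0) : IsLAS f p := by
  refine isLAS_of_eventually_abs_lt hfix
    (hf.eventually_analyticAt.mono fun x hx => hx.continuousAt) ?_
  have h := hf.differentiableAt.hasDerivAt.isLittleO
  filter_upwards [h.def (c := 1 / 2) (by norm_num)] with x hx hxp
  have := abs_pos.2 (sub_ne_zero.2 hxp)
  simp only [hd, hfix, smul_zero, sub_zero, Real.norm_eq_abs] at hx
  linarith

/-- if `p` is a common LAS fixed point of two analytic self-maps of an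
open set `U ⊆ ℝ`, then `p` is LAS or semi-AS for the composition `f₂ ∘ f₁`. -/
theorem stmt0 (U : Set ℝ) (hUopen : IsOpen U) (f₁ f₂ : ℝ → ℝ)
    (h₁U : Set.MapsTo f₁ U U) (h₂U : Set.MapsTo f₂ U U)
    (h₁a : AnalyticOnNhd ℝ f₁ U) (h₂a : AnalyticOnNhd ℝ f₂ U)
    (p : ℝ) (hp : p ∈ U) (hfix₁ : f₁ p = p) (hfix₂ : f₂ p = p)
    (hLAS₁ : IsLAS f₁ p) (hLAS₂ : IsLAS f₂ p) :
    IsLAS (f₂ ∘ f₁) p ∨ IsSemiAS (f₂ ∘ f₁) p := by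
  have a₁ := h₁a p hp
  have a₂ := h₂a p hp
  have a₂' : AnalyticAt ℝ f₂ (f₁ p) := by rwa [hfix₁]
  have ag : AnalyticAt ℝ (f₂ ∘ f₁) p := a₂'.comp a₁
  have hfix : (f₂ ∘ f₁) p = p := by simp [hfix₁, hfix₂]
  have hcont : ∀ {f : ℝ → ℝ}, AnalyticAt ℝ f p → ∀ᶠ x in 𝓝 p, ContinuousAt f x :=
    fun hf => hf.eventually_analyticAt.mono fun x hx => hx.continuousAt
  have hderiv : deriv (f₂ ∘ f₁) p = deriv f₂ p * deriv f₁ p := by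
    rw [deriv_comp p a₂'.differentiableAt a₁.differentiableAt, hfix₁]
  have agg : AnalyticAt ℝ ((f₂ ∘ f₁) ∘ (f₂ ∘ f₁)) p := AnalyticAt.comp (by rwa [hfix]) ag
  have between_sq : ∀ {f : ℝ → ℝ}, IsLAS f p → AnalyticAt ℝ f p → deriv f p < 0 → f p = p →
      ∀ᶠ x in 𝓝 p, (p < x → p < f (f x) ∧ f (f x) < x) ∧ (x < p → x < f (f x) ∧ f (f x) < p) := by
    intro f hL hf hd hfp
    have hf' : AnalyticAt ℝ f (f p) := by rwa [hfp]
    refine hL.comp_self.eventually_between (hf'.comp hf) ?_ (by simp [hfp])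
    rw [deriv_comp p hf'.differentiableAt hf.differentiableAt, hfp]
    exact mul_pos_of_neg_of_neg hd hd
  have t₁ : Tendsto f₁ (𝓝 p) (𝓝 p) := by simpa only [hfix₁] using a₁.continuousAt.tendsto
  have t₂ : Tendsto f₂ (𝓝 p) (𝓝 p) := by simpa only [hfix₂] using a₂.continuousAt.tendsto
  have tc : Tendsto (fun _ : ℝ => p) (𝓝 p) (𝓝 p) := tendsto_const_nhds
  have ti : Tendsto (fun x : ℝ => x) (𝓝 p) (𝓝 p) := tendsto_id
  rcases lt_trichotomy (deriv f₁ p) 0 with d₁ | d₁ | d₁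
  · have b₁ := between_sq hLAS₁ a₁ d₁ hfix₁
    have m₁ := a₁.eventually_gt_of_deriv_neg d₁
    rcases lt_trichotomy (deriv f₂ p) 0 with d₂ | d₂ | d₂
    · have b₂ := between_sq hLAS₂ a₂ d₂ hfix₂
      have m₂ := a₂.eventually_gt_of_deriv_neg d₂
      have mg := ag.eventually_lt_of_deriv_pos (hderiv ▸ mul_pos_of_neg_of_neg d₂ d₁)
      have mr := (tc.prodMk ti).eventually mg
      have ml := (ti.prodMk tc).eventually mg
      simp only [hfix] at mr ml
      have not_both : ¬ ((∀ᶠ x in 𝓝 p, p < x → x ≤ f₂ (f₁ x)) ∧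
          ∀ᶠ x in 𝓝 p, x < p → f₂ (f₁ x) ≤ x) := by
        rintro ⟨hr, hl⟩
        have t₁₁ := t₁.comp t₁
        have t₂₁₁ := t₂.comp t₁₁
        obtain ⟨z, hz, e₁, e₂, e₃, e₄, e₅, e₆⟩ := ((frequently_gt_nhds p).and_eventually
          (b₁.and <| (t₁₁.eventually b₂).and <| ((tc.prodMk ti).eventually m₁).and <|
            (t₁.eventually hl).and <| hr.and <| (t₂₁₁.prodMk t₁).eventually m₂)).exists
        simp only [Function.comp_apply, hfix₁] at e₁ e₂ e₃ e₄ e₅ e₆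
        grind
      rcases (ag.sub analyticAt_id).eventually_eq_zero_or_sign with h0 | ⟨hr | hr, hl | hl⟩
      · exact absurd ⟨h0.mono fun x hx _ => (sub_eq_zero.1 hx).ge,
          h0.mono fun x hx _ => (sub_eq_zero.1 hx).le⟩ not_both
      · right; right
        refine isSemiASRight_of_eventually hfix (hcont ag) ?_
          (hl.mono fun x hx hxp => sub_neg.1 (hx hxp))
        filter_upwards [mr, hr] with x h₁ h₂ hx
        exact ⟨h₁ hx, sub_neg.1 (h₂ hx)⟩
      · left
        refine isLAS_of_eventually_between hfix (hcont ag) ?_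
        filter_upwards [mr, ml, hr, hl] with x h₁ h₂ h₃ h₄
        exact ⟨fun hx => ⟨h₁ hx, sub_neg.1 (h₃ hx)⟩, fun hx => ⟨sub_pos.1 (h₄ hx), h₂ hx⟩⟩
      · exact absurd ⟨hr.mono fun x hx hxp => (sub_pos.1 (hx hxp)).le,
          hl.mono fun x hx hxp => (sub_neg.1 (hx hxp)).le⟩ not_both
      · right; left
        refine isSemiASLeft_of_eventually hfix (hcont ag) ?_
          (hr.mono fun x hx hxp => sub_pos.1 (hx hxp))
        filter_upwards [ml, hl] with x h₁ h₂ hx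
        exact ⟨sub_pos.1 (h₂ hx), h₁ hx⟩
    · exact Or.inl (isLAS_of_deriv_eq_zero ag hfix (by simp [hderiv, d₂]))
    · left
      have b₂ := hLAS₂.eventually_between a₂ d₂ hfix₂
      refine IsLAS.of_comp_self hfix ag.continuousAt
        (isLAS_of_eventually_between (by simp [hfix₁, hfix₂]) (hcont agg) ?_)
      have tg := t₂.comp t₁
      have tfg := t₁.comp tg
      filter_upwards [b₁, t₁.eventually b₂, tfg.eventually b₂, (ti.prodMk tc).eventually m₁,
        (tc.prodMk ti).eventually m₁, (tg.prodMk tc).eventually m₁, (tc.prodMk tg).eventually m₁,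
        (tg.prodMk t₁).eventually m₁, (t₁.prodMk tg).eventually m₁]
        with x e₁ e₂ e₃ e₄ e₅ e₆ e₇ e₈ e₉
      simp only [Function.comp_apply, hfix₁] at e₁ e₂ e₃ e₄ e₅ e₆ e₇ e₈ e₉ ⊢
      grind
  · exact Or.inl (isLAS_of_deriv_eq_zero ag hfix (by simp [hderiv, d₁]))
  · left
    have b₁ := hLAS₁.eventually_between a₁ d₁ hfix₁
    rcases lt_trichotomy (deriv f₂ p) 0 with d₂ | d₂ | d₂
    · have b₂ := between_sq hLAS₂ a₂ d₂ hfix₂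
      have m₂ := a₂.eventually_gt_of_deriv_neg d₂
      refine IsLAS.of_comp_self hfix ag.continuousAt
        (isLAS_of_eventually_between (by simp [hfix₁, hfix₂]) (hcont agg) ?_)
      have tg := t₂.comp t₁
      have tfg := t₁.comp tg
      filter_upwards [b₁, b₂, tg.eventually b₁, (t₁.prodMk tc).eventually m₂,
        (tc.prodMk t₁).eventually m₂, (tfg.prodMk tc).eventually m₂, (tc.prodMk tfg).eventually m₂,
        (t₁.prodMk ti).eventually m₂, (ti.prodMk t₁).eventually m₂,
        (tfg.prodMk t₂).eventually m₂, (t₂.prodMk tfg).eventually m₂]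
        with x e₁ e₂ e₃ e₄ e₅ e₆ e₇ e₈ e₉ e₁₀ e₁₁
      simp only [Function.comp_apply, hfix₂] at e₁ e₂ e₃ e₄ e₅ e₆ e₇ e₈ e₉ e₁₀ e₁₁ ⊢
      grind
    · exact isLAS_of_deriv_eq_zero ag hfix (by simp [hderiv, d₂])
    · have b₂ := hLAS₂.eventually_between a₂ d₂ hfix₂
      refine isLAS_of_eventually_between hfix (hcont ag) ?_
      filter_upwards [b₁, t₁.eventually b₂] with x e₁ e₂
      simp only [Function.comp_apply]
      grind
end

section
/- Let U ⊆ ℝ be an open set and let f₁, f₂ : U → U be real-analytic maps having a common fixed point p ∈ U which is a repeller for both f₁ and f₂. Then p is either a repeller or semi-asymptotically stable (semi-AS, i.e. semi-AS from the left or from the right) for the composition map f₂ ∘ f₁. -/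
open Filter Topology

/-- Small forward invariant sets containing a point other than `p` prevent `p` from being
a repeller. -/
lemma not_isRepeller_of_invariant {f : ℝ → ℝ} {p : ℝ}
    (h : ∀ ε > 0, ∃ S ⊆ Metric.ball p ε, Set.MapsTo f S S ∧ ∃ x ∈ S, x ≠ p) :
    ¬ IsRepeller f p := by
  rintro ⟨ε₀, hε₀, H⟩
  obtain ⟨S, hS, hmaps, x, hx, hxp⟩ := h (ε₀ / 2) (by positivity)
  have hball : ∀ y ∈ S, |y - p| < ε₀ / 2 := fun y hy => by
    simpa [Real.dist_eq] using hS hy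
  obtain ⟨n, hn⟩ := H (ε₀ / 2) (by positivity) (by linarith) x hxp (hball x hx)
  exact absurd hn (not_lt.2 (hball _ (hmaps.iterate n hx)).le)

lemma IsRepeller.of_comp_self {f : ℝ → ℝ} {p : ℝ} (h : IsRepeller (f ∘ f) p) :
    IsRepeller f p := by
  obtain ⟨ε₀, hε₀, H⟩ := h
  refine ⟨ε₀, hε₀, fun ε hε hε' x hx hxε => ?_⟩
  obtain ⟨n, hn⟩ := H ε hε hε' x hx hxε
  refine ⟨2 * n, ?_⟩
  rwa [Function.iterate_mul]

lemma IsRepeller.deriv_ne_zero {f : ℝ → ℝ} {p : ℝ} (h : IsRepeller f p)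
    (hf : DifferentiableAt ℝ f p) (hp : f p = p) : deriv f p ≠ 0 := by
  intro h0
  refine not_isRepeller_of_invariant (fun ε hε => ?_) h
  have hd := hf.hasDerivAt
  rw [h0, hasDerivAt_iff_isLittleO] at hd
  have hb := hd.bound (c := 1) one_pos
  obtain ⟨r, hr, hball⟩ := Metric.eventually_nhds_iff.1 hb
  have hδ : 0 < min ε r := lt_min hε hr
  refine ⟨Metric.ball p (min ε r), Metric.ball_subset_ball (min_le_left _ _), fun x hx => ?_,
    p + min ε r / 2, ?_, by linarith⟩
  · have hx' : dist x p < min ε r := hx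
    have := hball (hx'.trans_le (min_le_right _ _))
    simp only [smul_zero, sub_zero, hp, one_mul] at this
    rw [Metric.mem_ball, Real.dist_eq] at *
    exact lt_of_le_of_lt this hx'
  · rw [Metric.mem_ball, Real.dist_eq, add_sub_cancel_left, abs_of_pos] <;> linarith

/-- A function with continuous nonvanishing derivative is strictly monotone nearby. -/
lemma exists_strictMonoOn_or_strictAntiOn {f : ℝ → ℝ} {p : ℝ} (hf : AnalyticAt ℝ f p)
    (h : deriv f p ≠ 0) :
    ∃ V ∈ 𝓝 p, StrictMonoOn f V ∨ StrictAntiOn f V := by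
  have hc : ContinuousAt (deriv f) p := hf.deriv.continuousAt
  have hcont : ∀ᶠ x in 𝓝 p, ContinuousAt f x :=
    hf.eventually_analyticAt.mono fun x hx => hx.continuousAt
  rcases h.lt_or_gt with h | h
  · obtain ⟨r, hr, H⟩ :=
      Metric.eventually_nhds_iff_ball.1 (hcont.and (hc.eventually_lt_const h))
    exact ⟨_, Metric.ball_mem_nhds p hr, Or.inr <|
      strictAntiOn_of_deriv_neg (convex_ball p r)
        (fun x hx => (H x hx).1.continuousWithinAt)
        (fun x hx => (H x (interior_subset hx)).2)⟩
  · obtain ⟨r, hr, H⟩ :=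
      Metric.eventually_nhds_iff_ball.1 (hcont.and (hc.eventually_const_lt h))
    exact ⟨_, Metric.ball_mem_nhds p hr, Or.inl <|
      strictMonoOn_of_deriv_pos (convex_ball p r)
        (fun x hx => (H x hx).1.continuousWithinAt)
        (fun x hx => (H x (interior_subset hx)).2)⟩

section Monotone

variable {f : ℝ → ℝ} {p : ℝ} {V : Set ℝ}

lemma StrictMonoOn.tendsto_nhdsGT (hm : StrictMonoOn f V) (hV : V ∈ 𝓝 p)
    (hf : ContinuousAt f p) (hp : f p = p) : Tendsto f (𝓝[>] p) (𝓝[>] p) := by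
  refine tendsto_nhdsWithin_iff.2 ⟨?_, ?_⟩
  · simpa [hp] using hf.tendsto.mono_left nhdsWithin_le_nhds
  · filter_upwards [self_mem_nhdsWithin, nhdsWithin_le_nhds hV] with x hx hxV
    simpa [hp] using hm (mem_of_mem_nhds hV) hxV hx

lemma StrictMonoOn.tendsto_nhdsLT (hm : StrictMonoOn f V) (hV : V ∈ 𝓝 p)
    (hf : ContinuousAt f p) (hp : f p = p) : Tendsto f (𝓝[<] p) (𝓝[<] p) := by
  refine tendsto_nhdsWithin_iff.2 ⟨?_, ?_⟩
  · simpa [hp] using hf.tendsto.mono_left nhdsWithin_le_nhds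
  · filter_upwards [self_mem_nhdsWithin, nhdsWithin_le_nhds hV] with x hx hxV
    simpa [hp] using hm hxV (mem_of_mem_nhds hV) hx

lemma StrictAntiOn.tendsto_nhdsGT (hm : StrictAntiOn f V) (hV : V ∈ 𝓝 p)
    (hf : ContinuousAt f p) (hp : f p = p) : Tendsto f (𝓝[>] p) (𝓝[<] p) := by
  refine tendsto_nhdsWithin_iff.2 ⟨?_, ?_⟩
  · simpa [hp] using hf.tendsto.mono_left nhdsWithin_le_nhds
  · filter_upwards [self_mem_nhdsWithin, nhdsWithin_le_nhds hV] with x hx hxV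
    simpa [hp] using hm (mem_of_mem_nhds hV) hxV hx

lemma StrictAntiOn.tendsto_nhdsLT (hm : StrictAntiOn f V) (hV : V ∈ 𝓝 p)
    (hf : ContinuousAt f p) (hp : f p = p) : Tendsto f (𝓝[<] p) (𝓝[>] p) := by
  refine tendsto_nhdsWithin_iff.2 ⟨?_, ?_⟩
  · simpa [hp] using hf.tendsto.mono_left nhdsWithin_le_nhds
  · filter_upwards [self_mem_nhdsWithin, nhdsWithin_le_nhds hV] with x hx hxV
    simpa [hp] using hm hxV (mem_of_mem_nhds hV) hx

/-- A repeller admits no invariant intervals `[a y, b y]` shrinking to `p` as `y → p`. -/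
lemma IsRepeller.eventually_not_mapsTo_Icc (h : IsRepeller f p) {a b : ℝ → ℝ} {l : Filter ℝ}
    (ha : Tendsto a l (𝓝 p)) (hb : Tendsto b l (𝓝 p)) :
    ∀ᶠ y in l, ¬ (a y ≤ b y ∧ (a y ≠ p ∨ b y ≠ p) ∧
      Set.MapsTo f (Set.Icc (a y) (b y)) (Set.Icc (a y) (b y))) := by
  by_contra hcon
  refine not_isRepeller_of_invariant (fun ε hε => ?_) h
  have hev := (ha.eventually (Metric.ball_mem_nhds p hε)).and
    (hb.eventually (Metric.ball_mem_nhds p hε))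
  obtain ⟨y, hy, hya, hyb⟩ := ((Filter.not_eventually.1 hcon).and_eventually hev).exists
  obtain ⟨hab, hne, hmaps⟩ := not_not.1 hy
  refine ⟨Set.Icc (a y) (b y), (convex_ball p ε).ordConnected.out hya hyb, hmaps, ?_⟩
  rcases hne with hne | hne
  · exact ⟨a y, ⟨le_rfl, hab⟩, hne⟩
  · exact ⟨b y, ⟨hab, le_rfl⟩, hne⟩

lemma eventually_Icc_subset {a b : ℝ → ℝ} {l : Filter ℝ} (hV : V ∈ 𝓝 p)
    (ha : Tendsto a l (𝓝 p)) (hb : Tendsto b l (𝓝 p)) :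
    ∀ᶠ y in l, Set.Icc (a y) (b y) ⊆ V := by
  obtain ⟨ε, hε, hεV⟩ := Metric.mem_nhds_iff.1 hV
  filter_upwards [ha.eventually (Metric.ball_mem_nhds p hε),
    hb.eventually (Metric.ball_mem_nhds p hε)] with y hya hyb
  exact ((convex_ball p ε).ordConnected.out hya hyb).trans hεV

lemma StrictMonoOn.mapsTo_Icc {a b : ℝ} (hm : StrictMonoOn f V) (hab : a ≤ b)
    (hV : Set.Icc a b ⊆ V) (ha : a ≤ f a) (hb : f b ≤ b) :
    Set.MapsTo f (Set.Icc a b) (Set.Icc a b) := fun _ hx =>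
  ⟨ha.trans (hm.monotoneOn (hV ⟨le_rfl, hab⟩) (hV hx) hx.1),
    (hm.monotoneOn (hV hx) (hV ⟨hab, le_rfl⟩) hx.2).trans hb⟩

lemma StrictAntiOn.mapsTo_Icc {a b : ℝ} (hm : StrictAntiOn f V) (hab : a ≤ b)
    (hV : Set.Icc a b ⊆ V) (ha : f a ≤ b) (hb : a ≤ f b) :
    Set.MapsTo f (Set.Icc a b) (Set.Icc a b) := fun _ hx =>
  ⟨hb.trans (hm.antitoneOn (hV hx) (hV ⟨hab, le_rfl⟩) hx.2),
    (hm.antitoneOn (hV ⟨le_rfl, hab⟩) (hV hx) hx.1).trans ha⟩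

lemma tendsto_id_nhdsWithin_nhds {s : Set ℝ} : Tendsto (fun y : ℝ => y) (𝓝[s] p) (𝓝 p) :=
  tendsto_id.mono_left nhdsWithin_le_nhds

lemma IsRepeller.eventually_lt_of_strictMonoOn (h : IsRepeller f p) (hm : StrictMonoOn f V)
    (hV : V ∈ 𝓝 p) (hp : f p = p) : ∀ᶠ x in 𝓝[>] p, x < f x := by
  filter_upwards [h.eventually_not_mapsTo_Icc (tendsto_const_nhds (x := p))
      tendsto_id_nhdsWithin_nhds,
    eventually_Icc_subset hV (tendsto_const_nhds (x := p)) tendsto_id_nhdsWithin_nhds,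
    self_mem_nhdsWithin] with x hx hxV hpx
  have hpx' : p < x := hpx
  by_contra! hle
  exact hx ⟨hpx'.le, Or.inr hpx'.ne', hm.mapsTo_Icc hpx'.le hxV hp.ge hle⟩

lemma IsRepeller.eventually_gt_of_strictMonoOn (h : IsRepeller f p) (hm : StrictMonoOn f V)
    (hV : V ∈ 𝓝 p) (hp : f p = p) : ∀ᶠ x in 𝓝[<] p, f x < x := by
  filter_upwards [h.eventually_not_mapsTo_Icc tendsto_id_nhdsWithin_nhds
      (tendsto_const_nhds (x := p)),
    eventually_Icc_subset hV tendsto_id_nhdsWithin_nhds (tendsto_const_nhds (x := p)),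
    self_mem_nhdsWithin] with x hx hxV hpx
  have hpx' : x < p := hpx
  by_contra! hle
  exact hx ⟨hpx'.le, Or.inl hpx'.ne, hm.mapsTo_Icc hpx'.le hxV hle hp.le⟩

lemma IsRepeller.eventually_lt_of_strictAntiOn (h : IsRepeller f p) (hm : StrictAntiOn f V)
    (hV : V ∈ 𝓝 p) (hf : ContinuousAt f p) (hp : f p = p) :
    ∀ᶠ x in 𝓝[>] p, x < f (f x) := by
  have ht := hm.tendsto_nhdsGT hV hf hp
  have ht' := ht.mono_right nhdsWithin_le_nhds
  filter_upwards [h.eventually_not_mapsTo_Icc ht' tendsto_id_nhdsWithin_nhds,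
    eventually_Icc_subset hV ht' tendsto_id_nhdsWithin_nhds,
    self_mem_nhdsWithin, ht.eventually self_mem_nhdsWithin] with x hx hxV hpx hfx
  have hpx' : p < x := hpx
  have hfx' : f x < p := hfx
  by_contra! hle
  exact hx ⟨(hfx'.trans hpx').le, Or.inr hpx'.ne',
    hm.mapsTo_Icc (hfx'.trans hpx').le hxV hle le_rfl⟩

lemma IsRepeller.eventually_gt_of_strictAntiOn (h : IsRepeller f p) (hm : StrictAntiOn f V)
    (hV : V ∈ 𝓝 p) (hf : ContinuousAt f p) (hp : f p = p) :
    ∀ᶠ x in 𝓝[<] p, f (f x) < x := by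
  have ht := hm.tendsto_nhdsLT hV hf hp
  have ht' := ht.mono_right nhdsWithin_le_nhds
  filter_upwards [h.eventually_not_mapsTo_Icc tendsto_id_nhdsWithin_nhds ht',
    eventually_Icc_subset hV tendsto_id_nhdsWithin_nhds ht',
    self_mem_nhdsWithin, ht.eventually self_mem_nhdsWithin] with x hx hxV hpx hfx
  have hpx' : x < p := hpx
  have hfx' : p < f x := hfx
  by_contra! hle
  exact hx ⟨(hpx'.trans hfx').le, Or.inl hpx'.ne,
    hm.mapsTo_Icc (hpx'.trans hfx').le hxV le_rfl hle⟩

end Monotone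

section Escape

variable {h : ℝ → ℝ} {p : ℝ}

lemma iterate_neg_conj (h : ℝ → ℝ) (n : ℕ) (x : ℝ) :
    (fun y => -h (-y))^[n] x = -h^[n] (-x) := by
  induction n generalizing x with
  | zero => simp
  | succ n ih => simp [ih]

lemma abs_iterate_neg_conj (h : ℝ → ℝ) (p : ℝ) (n : ℕ) (x : ℝ) :
    |(fun y => -h (-y))^[n] (-x) - -p| = |h^[n] x - p| := by
  rw [iterate_neg_conj, neg_neg, ← abs_neg]
  congr 1
  ring

lemma exists_iterate_gt_right {r ε x : ℝ} (hc : ∀ y ∈ Set.Ioo p (p + r), ContinuousAt h y)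
    (hlt : ∀ y ∈ Set.Ioo p (p + r), y < h y) (hε : ε < r) (hx : p < x) :
    ∃ n, |h^[n] x - p| > ε := by
  by_contra! hcon
  have hup : ∀ n, h^[n] x ≤ p + ε := fun n => by linarith [(abs_le.1 (hcon n)).2]
  have hlow : ∀ n, x ≤ h^[n] x := by
    intro n
    induction n with
    | zero => exact le_rfl
    | succ n ih =>
      rw [Function.iterate_succ_apply']
      exact ih.trans (hlt _ ⟨hx.trans_le ih, by linarith [hup n]⟩).le
  have hmono : Monotone fun n => h^[n] x := monotone_nat_of_le_succ fun n => by
    rw [Function.iterate_succ_apply']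
    exact (hlt _ ⟨hx.trans_le (hlow n), by linarith [hup n]⟩).le
  have ht := tendsto_atTop_ciSup hmono ⟨p + ε, by rintro _ ⟨n, rfl⟩; exact hup n⟩
  set L := ⨆ n, h^[n] x
  have hL : L ∈ Set.Ioo p (p + r) :=
    ⟨hx.trans_le (ge_of_tendsto' ht hlow), (le_of_tendsto' ht hup).trans_lt (by linarith)⟩
  exact (hlt L hL).ne' (isFixedPt_of_tendsto_iterate ht (hc L hL))

lemma exists_iterate_gt_left {r ε x : ℝ} (hc : ∀ y ∈ Set.Ioo (p - r) p, ContinuousAt h y)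
    (hlt : ∀ y ∈ Set.Ioo (p - r) p, h y < y) (hε : ε < r) (hx : x < p) :
    ∃ n, |h^[n] x - p| > ε := by
  have hmem : ∀ y ∈ Set.Ioo (-p) (-p + r), -y ∈ Set.Ioo (p - r) p := fun y hy =>
    ⟨by linarith [hy.2], by linarith [hy.1]⟩
  obtain ⟨n, hn⟩ := exists_iterate_gt_right (h := fun y => -h (-y)) (p := -p) (x := -x)
    (fun y hy => (ContinuousAt.comp (hc _ (hmem y hy)) continuousAt_neg).neg)
    (fun y hy => by linarith [hlt _ (hmem y hy)]) hε (neg_lt_neg hx)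
  exact ⟨n, by rwa [abs_iterate_neg_conj] at hn⟩

lemma eventually_nhdsGT_iff {P : ℝ → Prop} :
    (∀ᶠ y in 𝓝[>] p, P y) ↔ ∃ r > 0, ∀ y ∈ Set.Ioo p (p + r), P y := by
  constructor
  · intro H
    obtain ⟨u, hu, hsub⟩ := mem_nhdsGT_iff_exists_Ioo_subset.1 H
    refine ⟨u - p, sub_pos.2 hu, fun y hy => hsub ?_⟩
    rwa [add_sub_cancel] at hy
  · rintro ⟨r, hr, H⟩
    exact mem_of_superset (Ioo_mem_nhdsGT (by linarith)) H

lemma eventually_nhdsLT_iff {P : ℝ → Prop} :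
    (∀ᶠ y in 𝓝[<] p, P y) ↔ ∃ r > 0, ∀ y ∈ Set.Ioo (p - r) p, P y := by
  constructor
  · intro H
    obtain ⟨u, hu, hsub⟩ := mem_nhdsLT_iff_exists_Ioo_subset.1 H
    refine ⟨p - u, sub_pos.2 hu, fun y hy => hsub ?_⟩
    rwa [sub_sub_cancel] at hy
  · rintro ⟨r, hr, H⟩
    exact mem_of_superset (Ioo_mem_nhdsLT (by linarith)) H

lemma isRepeller_of_eventually (hc : ∀ᶠ y in 𝓝 p, ContinuousAt h y)
    (hR : ∀ᶠ y in 𝓝[>] p, y < h y) (hL : ∀ᶠ y in 𝓝[<] p, h y < y) : IsRepeller h p := by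
  obtain ⟨r, hr, HR⟩ := eventually_nhdsGT_iff.1 ((hc.filter_mono nhdsWithin_le_nhds).and hR)
  obtain ⟨s, hs, HL⟩ := eventually_nhdsLT_iff.1 ((hc.filter_mono nhdsWithin_le_nhds).and hL)
  refine ⟨min r s, lt_min hr hs, fun ε _ hε x hx _ => ?_⟩
  rcases hx.lt_or_gt with hx | hx
  · exact exists_iterate_gt_left (fun y hy => (HL y hy).1) (fun y hy => (HL y hy).2)
      (hε.trans_le (min_le_right _ _)) hx
  · exact exists_iterate_gt_right (fun y hy => (HR y hy).1) (fun y hy => (HR y hy).2)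
      (hε.trans_le (min_le_left _ _)) hx

lemma isSemiASRight_of_eventually_s1 (hc : ∀ᶠ y in 𝓝 p, ContinuousAt h y)
    (hpos : ∀ᶠ y in 𝓝[>] p, p < h y)
    (hR : ∀ᶠ y in 𝓝[>] p, h y < y) (hL : ∀ᶠ y in 𝓝[<] p, h y < y) :
    IsSemiASRight h p := by
  obtain ⟨r, hr, HR⟩ := eventually_nhdsGT_iff.1
    ((hc.filter_mono nhdsWithin_le_nhds).and (hpos.and hR))
  obtain ⟨s, hs, HL⟩ := eventually_nhdsLT_iff.1 ((hc.filter_mono nhdsWithin_le_nhds).and hL)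
  have horb : ∀ x ∈ Set.Ioo p (p + r), ∀ n, h^[n] x ∈ Set.Ioc p x := by
    intro x hx n
    induction n with
    | zero => exact ⟨hx.1, le_rfl⟩
    | succ n ih =>
      rw [Function.iterate_succ_apply']
      obtain ⟨-, h1, h2⟩ := HR _ ⟨ih.1, ih.2.trans_lt hx.2⟩
      exact ⟨h1, h2.le.trans ih.2⟩
  refine ⟨fun ε hε => ⟨min ε r, lt_min hε hr, fun x hx n _ => ?_⟩,
    ⟨r, hr, fun x hx => ?_⟩, ⟨s / 2, half_pos hs, fun x hx => ?_⟩⟩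
  · have h1 := min_le_left ε r
    have h2 := min_le_right ε r
    have h3 := horb x ⟨hx.1, by linarith [hx.2]⟩ n
    rw [abs_of_pos (sub_pos.2 h3.1)]
    linarith [hx.2, h3.2]
  · have hanti : Antitone fun n => h^[n] x := antitone_nat_of_succ_le fun n => by
      have ho := horb x hx n
      rw [Function.iterate_succ_apply']
      exact (HR _ ⟨ho.1, ho.2.trans_lt hx.2⟩).2.2.le
    have ht := tendsto_atTop_ciInf hanti
      ⟨p, by rintro _ ⟨n, rfl⟩; exact (horb x hx n).1.le⟩
    set L := ⨅ n, h^[n] x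
    have hpL : p ≤ L := ge_of_tendsto' ht fun n => (horb x hx n).1.le
    have hLx : L ≤ x := le_of_tendsto' ht fun n => (horb x hx n).2
    rcases hpL.eq_or_lt with hpL | hpL
    · rwa [hpL]
    · have H := HR L ⟨hpL, hLx.trans_lt hx.2⟩
      exact absurd (isFixedPt_of_tendsto_iterate ht H.1) H.2.2.ne
  · exact exists_iterate_gt_left (fun y hy => (HL y hy).1) (fun y hy => (HL y hy).2)
      (half_lt_self hs) hx.2

lemma IsSemiASRight.of_neg_conj (H : IsSemiASRight (fun y => -h (-y)) (-p)) :
    IsSemiASLeft h p := by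
  have hGT : ∀ {x δ : ℝ}, x ∈ Set.Ioo (p - δ) p → -x ∈ Set.Ioo (-p) (-p + δ) :=
    fun hx => ⟨by linarith [hx.2], by linarith [hx.1]⟩
  have hLT : ∀ {x δ : ℝ}, x ∈ Set.Ioo p (p + δ) → -x ∈ Set.Ioo (-p - δ) (-p) :=
    fun hx => ⟨by linarith [hx.2], by linarith [hx.1]⟩
  obtain ⟨H1, ⟨η, hη, H2⟩, ⟨θ, hθ, H3⟩⟩ := H
  refine ⟨fun ε hε => ?_, ⟨η, hη, fun x hx => ?_⟩, ⟨θ, hθ, fun x hx => ?_⟩⟩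
  · obtain ⟨δ, hδ, H⟩ := H1 ε hε
    refine ⟨δ, hδ, fun x hx n hn => ?_⟩
    simpa only [abs_iterate_neg_conj] using H (-x) (hGT hx) n hn
  · simpa [iterate_neg_conj] using (H2 (-x) (hGT hx)).neg
  · obtain ⟨n, hn⟩ := H3 (-x) (hLT hx)
    exact ⟨n, by rwa [abs_iterate_neg_conj] at hn⟩

lemma isSemiASLeft_of_eventually_s1 (hc : ∀ᶠ y in 𝓝 p, ContinuousAt h y)
    (hneg : ∀ᶠ y in 𝓝[<] p, h y < p)
    (hL : ∀ᶠ y in 𝓝[<] p, y < h y) (hR : ∀ᶠ y in 𝓝[>] p, y < h y) :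
    IsSemiASLeft h p := by
  have hGT : Tendsto (fun y : ℝ => -y) (𝓝[>] (-p)) (𝓝[<] p) := by
    simpa using tendsto_neg_nhdsGT (a := -p)
  have hLT : Tendsto (fun y : ℝ => -y) (𝓝[<] (-p)) (𝓝[>] p) := by
    simpa using tendsto_neg_nhdsLT (a := -p)
  have hN : Tendsto (fun y : ℝ => -y) (𝓝 (-p)) (𝓝 p) := by
    simpa using (continuous_neg (G := ℝ)).tendsto (-p)
  refine IsSemiASRight.of_neg_conj (isSemiASRight_of_eventually_s1 ?_ ?_ ?_ ?_)
  · filter_upwards [hN.eventually hc] with y hy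
    exact (ContinuousAt.comp hy continuousAt_neg).neg
  · filter_upwards [hGT.eventually hneg] with y hy using by linarith
  · filter_upwards [hGT.eventually hL] with y hy using by linarith
  · filter_upwards [hLT.eventually hR] with y hy using by linarith

end Escape

/-- An analytic function has a constant sign on each side of a point, unless it vanishes nearby. -/
lemma AnalyticAt.eventually_sign {d : ℝ → ℝ} {p : ℝ} (hd : AnalyticAt ℝ d p) :
    (∀ᶠ x in 𝓝 p, d x = 0) ∨
    (((∀ᶠ x in 𝓝[>] p, 0 < d x) ∨ (∀ᶠ x in 𝓝[>] p, d x < 0)) ∧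
      ((∀ᶠ x in 𝓝[<] p, 0 < d x) ∨ (∀ᶠ x in 𝓝[<] p, d x < 0))) := by
  rw [or_iff_not_imp_left]
  intro h0
  obtain ⟨n, k, hk, hkp, hdk⟩ := hd.exists_eventuallyEq_pow_smul_nonzero_iff.2 h0
  have hR := hdk.filter_mono (nhdsWithin_le_nhds (s := Set.Ioi p))
  have hL := hdk.filter_mono (nhdsWithin_le_nhds (s := Set.Iio p))
  rcases hkp.lt_or_gt with hkp | hkp
  · have hks := hk.continuousAt.eventually_lt_const hkp
    constructor
    · right
      filter_upwards [hR, hks.filter_mono nhdsWithin_le_nhds, self_mem_nhdsWithin] with x h1 h2 h3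
      rw [h1]
      exact mul_neg_of_pos_of_neg (pow_pos (sub_pos.2 h3) n) h2
    · rcases n.even_or_odd with hn | hn
      · right
        filter_upwards [hL, hks.filter_mono nhdsWithin_le_nhds, self_mem_nhdsWithin]
          with x h1 h2 h3
        rw [h1]
        exact mul_neg_of_pos_of_neg (hn.pow_pos (sub_neg.2 h3).ne) h2
      · left
        filter_upwards [hL, hks.filter_mono nhdsWithin_le_nhds, self_mem_nhdsWithin]
          with x h1 h2 h3
        rw [h1]
        exact mul_pos_of_neg_of_neg (hn.pow_neg (sub_neg.2 h3)) h2
  · have hks := hk.continuousAt.eventually_const_lt hkp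
    constructor
    · left
      filter_upwards [hR, hks.filter_mono nhdsWithin_le_nhds, self_mem_nhdsWithin] with x h1 h2 h3
      rw [h1]
      exact mul_pos (pow_pos (sub_pos.2 h3) n) h2
    · rcases n.even_or_odd with hn | hn
      · left
        filter_upwards [hL, hks.filter_mono nhdsWithin_le_nhds, self_mem_nhdsWithin]
          with x h1 h2 h3
        rw [h1]
        exact mul_pos (hn.pow_pos (sub_neg.2 h3).ne) h2
      · right
        filter_upwards [hL, hks.filter_mono nhdsWithin_le_nhds, self_mem_nhdsWithin]
          with x h1 h2 h3
        rw [h1]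
        exact mul_neg_of_neg_of_pos (hn.pow_neg (sub_neg.2 h3)) h2

/-- Orientation-reversing repellers cannot compose to a map that is weakly attracting on both
sides. -/
lemma not_attracting_comp_of_strictAntiOn {f₁ f₂ : ℝ → ℝ} {p : ℝ} {V₁ V₂ : Set ℝ}
    (hV₁ : V₁ ∈ 𝓝 p) (hV₂ : V₂ ∈ 𝓝 p) (hm₁ : StrictAntiOn f₁ V₁) (hm₂ : StrictAntiOn f₂ V₂)
    (hc₁ : ContinuousAt f₁ p) (hc₂ : ContinuousAt f₂ p) (hfix₁ : f₁ p = p) (hfix₂ : f₂ p = p)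
    (hRep₁ : IsRepeller f₁ p) (hRep₂ : IsRepeller f₂ p)
    (hR : ∀ᶠ x in 𝓝[>] p, f₂ (f₁ x) ≤ x) (hL : ∀ᶠ x in 𝓝[<] p, x ≤ f₂ (f₁ x)) : False := by
  have t₁ : Tendsto f₁ (𝓝 p) (𝓝 p) := by simpa [hfix₁] using hc₁.tendsto
  have t₂ : Tendsto f₂ (𝓝 p) (𝓝 p) := by simpa [hfix₂] using hc₂.tendsto
  have hleft : ∀ᶠ y in 𝓝[<] p, f₁ y < f₂ y := by
    filter_upwards [hL, hRep₂.eventually_gt_of_strictAntiOn hm₂ hV₂ hc₂ hfix₂,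
      (t₁.eventually hV₂).filter_mono nhdsWithin_le_nhds,
      (t₂.eventually hV₂).filter_mono nhdsWithin_le_nhds] with y h1 h2 h3 h4
    exact (hm₂.lt_iff_gt h4 h3).1 (h2.trans_le h1)
  obtain ⟨x, h1, h2, h3⟩ := (hR.and ((hRep₁.eventually_lt_of_strictAntiOn hm₁ hV₁ hc₁ hfix₁).and
    ((hm₁.tendsto_nhdsGT hV₁ hc₁ hfix₁).eventually hleft))).exists
  linarith

lemma isRepeller_comp_of_strictMonoOn_strictAntiOn {f₁ f₂ : ℝ → ℝ} {p : ℝ} {V₁ V₂ : Set ℝ}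
    (hV₁ : V₁ ∈ 𝓝 p) (hV₂ : V₂ ∈ 𝓝 p) (hm₁ : StrictMonoOn f₁ V₁) (hm₂ : StrictAntiOn f₂ V₂)
    (hc₁ : ContinuousAt f₁ p) (hc₂ : ContinuousAt f₂ p) (hfix₁ : f₁ p = p) (hfix₂ : f₂ p = p)
    (hRep₁ : IsRepeller f₁ p) (hRep₂ : IsRepeller f₂ p)
    (hc : ∀ᶠ y in 𝓝 p, ContinuousAt ((f₂ ∘ f₁) ∘ (f₂ ∘ f₁)) y) :
    IsRepeller (f₂ ∘ f₁) p := by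
  have t₁ : Tendsto f₁ (𝓝 p) (𝓝 p) := by simpa [hfix₁] using hc₁.tendsto
  have t₂ : Tendsto f₂ (𝓝 p) (𝓝 p) := by simpa [hfix₂] using hc₂.tendsto
  have hV : ∀ᶠ x in 𝓝 p, x ∈ V₂ ∧ f₁ x ∈ V₂ ∧ f₂ x ∈ V₂ ∧ f₁ (f₂ (f₁ x)) ∈ V₂ := by
    filter_upwards [hV₂, t₁.eventually hV₂, t₂.eventually hV₂,
      ((t₁.comp t₂).comp t₁).eventually hV₂] with x h1 h2 h3 h4 using ⟨h1, h2, h3, h4⟩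
  have g₁ := hm₁.tendsto_nhdsGT hV₁ hc₁ hfix₁
  have l₁ := hm₁.tendsto_nhdsLT hV₁ hc₁ hfix₁
  have g₂ := hm₂.tendsto_nhdsGT hV₂ hc₂ hfix₂
  have l₂ := hm₂.tendsto_nhdsLT hV₂ hc₂ hfix₂
  have r₁ := hRep₁.eventually_lt_of_strictMonoOn hm₁ hV₁ hfix₁
  have s₁ := hRep₁.eventually_gt_of_strictMonoOn hm₁ hV₁ hfix₁
  refine .of_comp_self (isRepeller_of_eventually hc ?_ ?_)
  · filter_upwards [hV.filter_mono nhdsWithin_le_nhds, r₁, (g₂.comp g₁).eventually s₁,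
      hRep₂.eventually_lt_of_strictAntiOn hm₂ hV₂ hc₂ hfix₂] with x ⟨h1, h2, h3, h4⟩ h5 h6 h7
    exact h7.trans (hm₂ h4 h3 (lt_trans h6 (hm₂ h1 h2 h5)))
  · filter_upwards [hV.filter_mono nhdsWithin_le_nhds, s₁, (l₂.comp l₁).eventually r₁,
      hRep₂.eventually_gt_of_strictAntiOn hm₂ hV₂ hc₂ hfix₂] with x ⟨h1, h2, h3, h4⟩ h5 h6 h7
    exact (hm₂ h3 h4 ((hm₂ h2 h1 h5).trans h6)).trans h7

lemma isRepeller_comp_of_strictAntiOn_strictMonoOn {f₁ f₂ : ℝ → ℝ} {p : ℝ} {V₁ V₂ : Set ℝ}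
    (hV₁ : V₁ ∈ 𝓝 p) (hV₂ : V₂ ∈ 𝓝 p) (hm₁ : StrictAntiOn f₁ V₁) (hm₂ : StrictMonoOn f₂ V₂)
    (hc₁ : ContinuousAt f₁ p) (hc₂ : ContinuousAt f₂ p) (hfix₁ : f₁ p = p) (hfix₂ : f₂ p = p)
    (hRep₁ : IsRepeller f₁ p) (hRep₂ : IsRepeller f₂ p)
    (hc : ∀ᶠ y in 𝓝 p, ContinuousAt ((f₂ ∘ f₁) ∘ (f₂ ∘ f₁)) y) :
    IsRepeller (f₂ ∘ f₁) p := by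
  have t₁ : Tendsto f₁ (𝓝 p) (𝓝 p) := by simpa [hfix₁] using hc₁.tendsto
  have t₂ : Tendsto f₂ (𝓝 p) (𝓝 p) := by simpa [hfix₂] using hc₂.tendsto
  have hV : ∀ᶠ x in 𝓝 p, f₁ x ∈ V₁ ∧ f₂ (f₁ x) ∈ V₁ := by
    filter_upwards [t₁.eventually hV₁, (t₂.comp t₁).eventually hV₁] with x h1 h2 using ⟨h1, h2⟩
  have g₁ := hm₁.tendsto_nhdsGT hV₁ hc₁ hfix₁
  have l₁ := hm₁.tendsto_nhdsLT hV₁ hc₁ hfix₁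
  have g₂ := hm₂.tendsto_nhdsGT hV₂ hc₂ hfix₂
  have l₂ := hm₂.tendsto_nhdsLT hV₂ hc₂ hfix₂
  have r₂ := hRep₂.eventually_lt_of_strictMonoOn hm₂ hV₂ hfix₂
  have s₂ := hRep₂.eventually_gt_of_strictMonoOn hm₂ hV₂ hfix₂
  refine .of_comp_self (isRepeller_of_eventually hc ?_ ?_)
  · filter_upwards [hV.filter_mono nhdsWithin_le_nhds, g₁.eventually s₂,
      ((l₁.comp l₂).comp g₁).eventually r₂,
      hRep₁.eventually_lt_of_strictAntiOn hm₁ hV₁ hc₁ hfix₁] with x ⟨h1, h2⟩ h3 h4 h5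
    exact h5.trans ((hm₁ h2 h1 h3).trans h4)
  · filter_upwards [hV.filter_mono nhdsWithin_le_nhds, l₁.eventually r₂,
      ((g₁.comp g₂).comp l₁).eventually s₂,
      hRep₁.eventually_gt_of_strictAntiOn hm₁ hV₁ hc₁ hfix₁] with x ⟨h1, h2⟩ h3 h4 h5
    exact (lt_trans h4 (hm₁ h1 h2 h3)).trans h5

/-- if `p` is a common repeller fixed point of two analytic self-maps of an
open set `U ⊆ ℝ`, then `p` is a repeller or semi-AS for the composition `f₂ ∘ f₁`. -/
theorem stmt1 (U : Set ℝ) (hUopen : IsOpen U) (f₁ f₂ : ℝ → ℝ)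
    (h₁U : Set.MapsTo f₁ U U) (h₂U : Set.MapsTo f₂ U U)
    (h₁a : AnalyticOnNhd ℝ f₁ U) (h₂a : AnalyticOnNhd ℝ f₂ U)
    (p : ℝ) (hp : p ∈ U) (hfix₁ : f₁ p = p) (hfix₂ : f₂ p = p)
    (hRep₁ : IsRepeller f₁ p) (hRep₂ : IsRepeller f₂ p) :
    IsRepeller (f₂ ∘ f₁) p ∨ IsSemiAS (f₂ ∘ f₁) p := by
  have a₁ := h₁a p hp
  have a₂ := h₂a p hp
  have c₁ := a₁.continuousAt
  have c₂ := a₂.continuousAt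
  obtain ⟨V₁, hV₁, hm₁⟩ := exists_strictMonoOn_or_strictAntiOn a₁
    (hRep₁.deriv_ne_zero a₁.differentiableAt hfix₁)
  obtain ⟨V₂, hV₂, hm₂⟩ := exists_strictMonoOn_or_strictAntiOn a₂
    (hRep₂.deriv_ne_zero a₂.differentiableAt hfix₂)
  have hga : AnalyticAt ℝ (f₂ ∘ f₁) p := a₂.comp_of_eq a₁ hfix₁
  have hgp : (f₂ ∘ f₁) p = p := by simp [hfix₁, hfix₂]
  have hgc : ∀ᶠ y in 𝓝 p, ContinuousAt (f₂ ∘ f₁) y :=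
    hga.eventually_analyticAt.mono fun y hy => hy.continuousAt
  have hggc : ∀ᶠ y in 𝓝 p, ContinuousAt ((f₂ ∘ f₁) ∘ (f₂ ∘ f₁)) y :=
    (hga.comp_of_eq hga hgp).eventually_analyticAt.mono fun y hy => hy.continuousAt
  rcases hm₁ with hm₁ | hm₁ <;> rcases hm₂ with hm₂ | hm₂
  · left
    refine isRepeller_of_eventually hgc ?_ ?_
    · filter_upwards [hRep₁.eventually_lt_of_strictMonoOn hm₁ hV₁ hfix₁,
        (hm₁.tendsto_nhdsGT hV₁ c₁ hfix₁).eventually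
          (hRep₂.eventually_lt_of_strictMonoOn hm₂ hV₂ hfix₂)] with x h1 h2 using h1.trans h2
    · filter_upwards [hRep₁.eventually_gt_of_strictMonoOn hm₁ hV₁ hfix₁,
        (hm₁.tendsto_nhdsLT hV₁ c₁ hfix₁).eventually
          (hRep₂.eventually_gt_of_strictMonoOn hm₂ hV₂ hfix₂)] with x h1 h2 using h2.trans h1
  · exact .inl (isRepeller_comp_of_strictMonoOn_strictAntiOn hV₁ hV₂ hm₁ hm₂ c₁ c₂ hfix₁ hfix₂
      hRep₁ hRep₂ hggc)
  · exact .inl (isRepeller_comp_of_strictAntiOn_strictMonoOn hV₁ hV₂ hm₁ hm₂ c₁ c₂ hfix₁ hfix₂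
      hRep₁ hRep₂ hggc)
  · have hnot := not_attracting_comp_of_strictAntiOn hV₁ hV₂ hm₁ hm₂ c₁ c₂ hfix₁ hfix₂ hRep₁ hRep₂
    have hGT := (hm₂.tendsto_nhdsLT hV₂ c₂ hfix₂).comp (hm₁.tendsto_nhdsGT hV₁ c₁ hfix₁)
    have hLT := (hm₂.tendsto_nhdsGT hV₂ c₂ hfix₂).comp (hm₁.tendsto_nhdsLT hV₁ c₁ hfix₁)
    rcases (hga.sub analyticAt_id).eventually_sign with h0 | ⟨hR | hR, hL | hL⟩
    · refine (hnot ?_ ?_).elim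
      · exact (h0.filter_mono nhdsWithin_le_nhds).mono fun x hx => (sub_eq_zero.1 hx).le
      · exact (h0.filter_mono nhdsWithin_le_nhds).mono fun x hx => (sub_eq_zero.1 hx).ge
    · exact .inr <| .inl <| isSemiASLeft_of_eventually_s1 hgc (hLT.eventually self_mem_nhdsWithin)
        (hL.mono fun x hx => sub_pos.1 hx) (hR.mono fun x hx => sub_pos.1 hx)
    · exact .inl <| isRepeller_of_eventually hgc (hR.mono fun x hx => sub_pos.1 hx)
        (hL.mono fun x hx => sub_neg.1 hx)
    · exact (hnot (hR.mono fun x hx => (sub_neg.1 hx).le)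
        (hL.mono fun x hx => (sub_pos.1 hx).le)).elim
    · exact .inr <| .inr <| isSemiASRight_of_eventually_s1 hgc (hGT.eventually self_mem_nhdsWithin)
        (hR.mono fun x hx => sub_neg.1 hx) (hL.mono fun x hx => sub_neg.1 hx)
end

section
/- For every integer k ≥ 3 there exist polynomial maps f₁, f₂, …, f_k : ℝ → ℝ sharing the common fixed point 0, such that 0 is locally asymptotically stable (LAS) for each f_i, i = 1, …, k, and 0 is a repeller for the composition map f_k ∘ f_{k−1} ∘ ⋯ ∘ f₁. -/
open Filter Topology

/-- `f` is a polynomial map. -/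
def IsPolyMap (f : ℝ → ℝ) : Prop := ∃ P : Polynomial ℝ, ∀ x, f x = P.eval x

/-- The composition `f k ∘ f (k-1) ∘ ⋯ ∘ f 1` (indices shifted to `Fin k`),
the map of the `k`-periodic system. -/
def compAll {k : ℕ} (f : Fin k → ℝ → ℝ) : ℝ → ℝ :=
  fun x => (List.ofFn f).foldl (fun y g => g y) x

open Polynomial in
/-- Congruence modulo `X ^ N` is preserved by composing on the left with a fixed polynomial. -/
lemma X_pow_dvd_comp_sub_comp {N : ℕ} {a b : ℝ[X]} (p : ℝ[X]) (h : X ^ N ∣ a - b) :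
    X ^ N ∣ p.comp a - p.comp b := by
  refine h.trans ?_
  have := sub_dvd_eval_sub a b (p.map C)
  rwa [eval_map, eval_map] at this

open Polynomial in
/-- Congruence modulo `X ^ N` is preserved by composing on the right with a polynomial
vanishing at `0`. -/
lemma X_pow_dvd_sub_comp {N : ℕ} {a b u : ℝ[X]} (h : X ^ N ∣ a - b) (hu : X ∣ u) :
    X ^ N ∣ a.comp u - b.comp u := by
  obtain ⟨d, hd⟩ := h
  rw [← sub_comp, hd, mul_comp, pow_comp, X_comp]
  exact (pow_dvd_pow_of_dvd hu N).mul_right _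

open Polynomial in
/-- A polynomial congruent to `X + c X ^ 5` modulo `X ^ 6` is `x + c x ^ 5` up to an error
of at most `|x| ^ 5` near `0`. -/
lemma exists_abs_eval_sub_le {P : ℝ[X]} {c : ℝ} (h : X ^ 6 ∣ P - (X + C c * X ^ 5)) :
    ∃ r > 0, ∀ x : ℝ, |x| < r → |P.eval x - (x + c * x ^ 5)| ≤ |x| ^ 5 := by
  obtain ⟨q, hq⟩ := h
  have hc : ContinuousAt (fun x : ℝ => x * q.eval x) 0 := by fun_prop
  obtain ⟨r, hr, H⟩ := Metric.continuousAt_iff.1 hc 1 one_pos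
  refine ⟨r, hr, fun x hx => ?_⟩
  have h1 : |x * q.eval x| < 1 := by
    simpa [Real.dist_eq] using H (show dist x 0 < r by simpa [Real.dist_eq] using hx)
  have h2 : P.eval x - (x + c * x ^ 5) = x ^ 5 * (x * q.eval x) := by
    have := congrArg (eval x) hq
    simp only [eval_sub, eval_add, eval_mul, eval_pow, eval_X, eval_C] at this
    rw [this]; ring
  rw [h2, abs_mul, abs_pow]
  exact mul_le_of_le_one_right (by positivity) h1.le

/-- If the second iterate of a continuous map contracts towards `0` at a polynomial rate,
then `0` is locally asymptotically stable. -/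
lemma isLAS_zero_of_abs_iterate_two_le {f : ℝ → ℝ} (hf : Continuous f) (h0 : f 0 = 0) {r : ℝ}
    (hr : 0 < r) (m : ℕ) (h : ∀ x, |x| < r → |f (f x)| ≤ |x| - |x| ^ m) : IsLAS f 0 := by
  have hstep : ∀ x n, f^[2 * (n + 1)] x = f (f (f^[2 * n] x)) := fun x n => by
    rw [show 2 * (n + 1) = 2 * n + 1 + 1 by ring, Function.iterate_succ_apply',
      Function.iterate_succ_apply']
  have hle : ∀ x, |x| < r → ∀ n, |f^[2 * n] x| ≤ |x| := by
    intro x hx n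
    induction n with
    | zero => simp
    | succ n ih =>
      rw [hstep]
      have := h _ (ih.trans_lt hx)
      have : 0 ≤ |f^[2 * n] x| ^ m := by positivity
      linarith
  have hdec : ∀ x, |x| < r → ∀ n,
      |f^[2 * (n + 1)] x| ≤ |f^[2 * n] x| - |f^[2 * n] x| ^ m := fun x hx n => by
    rw [hstep]
    exact h _ ((hle x hx n).trans_lt hx)
  have hodd : ∀ x n, f^[2 * n + 1] x = f (f^[2 * n] x) := fun x n =>
    Function.iterate_succ_apply' f (2 * n) x
  refine ⟨fun ε hε => ?_, r, hr, fun x hx => ?_⟩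
  · obtain ⟨d, hd, H⟩ := Metric.continuousAt_iff.1 (hf.continuousAt (x := 0)) ε hε
    refine ⟨min r (min ε d), by positivity, fun x hx n _ => ?_⟩
    simp only [sub_zero, lt_min_iff] at hx ⊢
    obtain ⟨k, rfl | rfl⟩ := n.even_or_odd'
    · exact (hle x hx.1 k).trans_lt hx.2.1
    · rw [hodd]
      have := H (show dist (f^[2 * k] x) 0 < d by
        simpa [Real.dist_eq] using (hle x hx.1 k).trans_lt hx.2.2)
      simpa [Real.dist_eq, h0] using this
  · rw [sub_zero] at hx
    have hanti : Antitone fun n => |f^[2 * n] x| := antitone_nat_of_succ_le fun n => by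
      have := hdec x hx n
      have : 0 ≤ |f^[2 * n] x| ^ m := by positivity
      linarith
    have hbdd : BddBelow (Set.range fun n => |f^[2 * n] x|) :=
      ⟨0, by rintro _ ⟨n, rfl⟩; exact abs_nonneg _⟩
    have hlim := tendsto_atTop_ciInf hanti hbdd
    set L := ⨅ n, |f^[2 * n] x|
    have hL : 0 ≤ L := le_ciInf fun n => abs_nonneg _
    have hLm : L ≤ L - L ^ m :=
      le_of_tendsto_of_tendsto' (hlim.comp (tendsto_add_atTop_nat 1)) (hlim.sub (hlim.pow m))
        (hdec x hx)
    have hL0 : L = 0 := by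
      by_contra hne
      have : 0 < L ^ m := pow_pos (lt_of_le_of_ne hL (Ne.symm hne)) m
      linarith
    rw [hL0] at hlim
    have heven : Tendsto (fun n => f^[2 * n] x) atTop (𝓝 0) :=
      (tendsto_zero_iff_abs_tendsto_zero _).2 hlim
    have hoddlim : Tendsto (fun n => f^[2 * n + 1] x) atTop (𝓝 0) := by
      have := (hf.tendsto 0).comp heven
      rw [h0] at this
      exact this.congr fun n => (hodd x n).symm
    rw [Metric.tendsto_atTop] at *
    intro ε hε
    obtain ⟨N₁, h₁⟩ := heven ε hε
    obtain ⟨N₂, h₂⟩ := hoddlim ε hε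
    refine ⟨2 * (N₁ + N₂) + 1, fun n hn => ?_⟩
    obtain ⟨k, rfl | rfl⟩ := n.even_or_odd'
    · exact h₁ k (by omega)
    · exact h₂ k (by omega)

/-- If the second iterate expands away from `0` at a polynomial rate, then `0` is a repeller. -/
lemma isRepeller_zero_of_le_abs_iterate_two {f : ℝ → ℝ} {r : ℝ} (hr : 0 < r) (m : ℕ)
    (h : ∀ x, |x| < r → |x| + |x| ^ m ≤ |f (f x)|) : IsRepeller f 0 := by
  refine ⟨r, hr, fun ε _ hεr x hx _ => ?_⟩
  by_contra! hcon
  simp only [sub_zero] at hcon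
  have hgrow : ∀ n : ℕ, |x| + n * |x| ^ m ≤ |f^[2 * n] x| := by
    intro n
    induction n with
    | zero => simp
    | succ n ih =>
      rw [show 2 * (n + 1) = 2 * n + 1 + 1 by ring, Function.iterate_succ_apply',
        Function.iterate_succ_apply']
      have h1 := h _ ((hcon (2 * n)).trans_lt hεr)
      have h2 : |x| ≤ |f^[2 * n] x| := by
        have : 0 ≤ n * |x| ^ m := by positivity
        linarith
      have h3 : |x| ^ m ≤ |f^[2 * n] x| ^ m := by gcongr
      push_cast
      linarith
  have hpos : 0 < |x| ^ m := pow_pos (abs_pos.2 hx) m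
  obtain ⟨n, hn⟩ := exists_nat_gt (ε / |x| ^ m)
  rw [div_lt_iff₀ hpos] at hn
  have := hgrow n
  have := hcon (2 * n)
  have := abs_nonneg x
  linarith

open Polynomial in
lemma isLAS_eval_of_X_pow_dvd {P : ℝ[X]} (h0 : P.eval 0 = 0)
    (h : X ^ 6 ∣ P.comp P - (X + C (-2) * X ^ 5)) : IsLAS (fun x => P.eval x) 0 := by
  obtain ⟨r, hr, H⟩ := exists_abs_eval_sub_le h
  refine isLAS_zero_of_abs_iterate_two_le P.continuous h0 (lt_min hr (by norm_num : 0 < (1 / 2 : ℝ)))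
    5 fun x hx => ?_
  rw [lt_min_iff] at hx
  have h1 := H x hx.1
  rw [eval_comp] at h1
  have h2 : |x| ^ 4 ≤ (1 / 2) ^ 4 := by gcongr; exact hx.2.le
  have h3 : |x + -2 * x ^ 5| = |x| - 2 * |x| ^ 5 := by
    have e : x + -2 * x ^ 5 = x * (1 - 2 * |x| ^ 4) := by
      rw [Even.pow_abs (by decide)]; ring
    rw [e, abs_mul, abs_of_nonneg (by linarith : 0 ≤ 1 - 2 * |x| ^ 4)]
    ring
  have := abs_sub_abs_le_abs_sub (P.eval (P.eval x)) (x + -2 * x ^ 5)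
  linarith

open Polynomial in
lemma isRepeller_eval_of_X_pow_dvd {P : ℝ[X]}
    (h : X ^ 6 ∣ P.comp P - (X + C 2 * X ^ 5)) : IsRepeller (fun x => P.eval x) 0 := by
  obtain ⟨r, hr, H⟩ := exists_abs_eval_sub_le h
  refine isRepeller_zero_of_le_abs_iterate_two hr 5 fun x hx => ?_
  have h1 := H x hx
  rw [eval_comp] at h1
  have h3 : |x + 2 * x ^ 5| = |x| + 2 * |x| ^ 5 := by
    have e : x + 2 * x ^ 5 = x * (1 + 2 * |x| ^ 4) := by
      rw [Even.pow_abs (by decide)]; ring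
    rw [e, abs_mul, abs_of_nonneg (by positivity : 0 ≤ 1 + 2 * |x| ^ 4)]
    ring
  have := abs_sub_abs_le_abs_sub (x + 2 * x ^ 5) (P.eval (P.eval x))
  rw [abs_sub_comm] at this
  linarith

lemma isLAS_sub_pow_seven : IsLAS (fun x => x - x ^ 7) 0 := by
  have h : ∀ x : ℝ, |x| < 1 → |x - x ^ 7| = |x| - |x| ^ 7 := fun x hx => by
    have h6 : |x| ^ 6 ≤ 1 := pow_le_one₀ (abs_nonneg x) hx.le
    have e : x - x ^ 7 = x * (1 - |x| ^ 6) := by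
      rw [Even.pow_abs (by decide)]; ring
    rw [e, abs_mul, abs_of_nonneg (by linarith : 0 ≤ 1 - |x| ^ 6)]
    ring
  refine isLAS_zero_of_abs_iterate_two_le (by fun_prop) (by norm_num) one_pos 7 fun x hx => ?_
  have h1 := h x hx
  have h2 : 0 ≤ |x| ^ 7 := by positivity
  have h3 := h (x - x ^ 7) (by linarith)
  have h4 : 0 ≤ |x - x ^ 7| ^ 7 := by positivity
  linarith

open Polynomial in
/-- Iterates of `X - X ^ 7` are congruent to `X` modulo `X ^ 6`. -/
lemma X_pow_dvd_iterate_comp_sub (n : ℕ) :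
    (X : ℝ[X]) ^ 6 ∣ (X - X ^ 7 : ℝ[X]).comp^[n] X - X := by
  induction n with
  | zero => simp
  | succ n ih =>
    rw [Function.iterate_succ_apply']
    have h1 := X_pow_dvd_comp_sub_comp (X - X ^ 7) ih
    have h2 : (X : ℝ[X]) ^ 6 ∣ (X - X ^ 7 : ℝ[X]).comp X - X := ⟨-X, by rw [comp_X]; ring⟩
    simpa only [sub_add_sub_cancel] using dvd_add h1 h2

open Polynomial in
/-- The first of three locally asymptotically stable maps whose composition is a repeller. -/
noncomputable def firstMap : ℝ[X] := -X - X ^ 2 - X ^ 3 - 2 * X ^ 4 - 3 * X ^ 5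

open Polynomial in
/-- The second of three locally asymptotically stable maps whose composition is a repeller. -/
noncomputable def secondMap : ℝ[X] := -X - X ^ 2 - X ^ 3 + 2 * X ^ 4 + 9 * X ^ 5

open Polynomial in
/-- The third of three locally asymptotically stable maps whose composition is a repeller. -/
noncomputable def thirdMap : ℝ[X] := -X + X ^ 5

open Polynomial in
lemma isLAS_firstMap : IsLAS (fun x => firstMap.eval x) 0 := by
  refine isLAS_eval_of_X_pow_dvd (by simp [firstMap]) ⟨
      -3 + 14 * X + 39 * X ^ 2 + 140 * X ^ 3 + 372 * X ^ 4 + 757 * X ^ 5 + 1437 * X ^ 6 + 2617 * X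
      ^ 7 + 4103 * X ^ 8 + 5876 * X ^ 9 + 8044 * X ^ 10 + 10035 * X ^ 11 + 11082 * X ^ 12 + 11508
      * X ^ 13 + 11094 * X ^ 14 + 9225 * X ^ 15 + 6615 * X ^ 16 + 4455 * X ^ 17 + 2430 * X ^ 18 +
      729 * X ^ 19, ?_⟩
  simp only [firstMap, sub_comp, neg_comp, mul_comp, pow_comp, X_comp, ofNat_comp, C_neg,
    map_ofNat]
  ring

open Polynomial in
lemma isLAS_secondMap : IsLAS (fun x => secondMap.eval x) 0 := by
  refine isLAS_eval_of_X_pow_dvd (by simp [secondMap]) ⟨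
      -3 - 130 * X - 317 * X ^ 2 - 36 * X ^ 3 + 1564 * X ^ 4 + 4997 * X ^ 5 + 5445 * X ^ 6 - 6995
      * X ^ 7 - 33433 * X ^ 8 - 56188 * X ^ 9 - 14080 * X ^ 10 + 120411 * X ^ 11 + 241866 * X ^ 12
      + 197244 * X ^ 13 - 174510 * X ^ 14 - 573075 * X ^ 15 - 499365 * X ^ 16 - 32805 * X ^ 17 +
      590490 * X ^ 18 + 531441 * X ^ 19, ?_⟩
  simp only [secondMap, add_comp, sub_comp, neg_comp, mul_comp, pow_comp, X_comp, ofNat_comp,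
    C_neg, map_ofNat]
  ring

open Polynomial in
lemma isLAS_thirdMap : IsLAS (fun x => thirdMap.eval x) 0 := by
  refine isLAS_eval_of_X_pow_dvd (by simp [thirdMap]) ⟨
      5 * X ^ 3 - 10 * X ^ 7 + 10 * X ^ 11 - 5 * X ^ 15 + X ^ 19, ?_⟩
  simp only [thirdMap, add_comp, neg_comp, pow_comp, X_comp, C_neg, map_ofNat]
  ring

open Polynomial in
lemma X_pow_dvd_secondMap_comp_firstMap :
    X ^ 6 ∣ secondMap.comp firstMap - (X + 4 * X ^ 4 + 2 * X ^ 5) := by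
  refine ⟨
      -23 - 70 * X - 221 * X ^ 2 - 660 * X ^ 3 - 1512 * X ^ 4 - 2959 * X ^ 5 - 5495 * X ^ 6 - 9391
      * X ^ 7 - 14165 * X ^ 8 - 19808 * X ^ 9 - 26284 * X ^ 10 - 31785 * X ^ 11 - 34542 * X ^ 12 -
      35388 * X ^ 13 - 33606 * X ^ 14 - 27675 * X ^ 15 - 19845 * X ^ 16 - 13365 * X ^ 17 - 7290 *
      X ^ 18 - 2187 * X ^ 19, ?_⟩
  simp only [firstMap, secondMap, add_comp, sub_comp, neg_comp, mul_comp, pow_comp, X_comp,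
    ofNat_comp]
  ring

open Polynomial in
lemma X_pow_dvd_thirdMap_comp_comp :
    X ^ 6 ∣ thirdMap.comp (secondMap.comp firstMap) - (-X - 4 * X ^ 4 - X ^ 5) := by
  have h1 := X_pow_dvd_comp_sub_comp thirdMap X_pow_dvd_secondMap_comp_firstMap
  have h2 : X ^ 6 ∣ thirdMap.comp (X + 4 * X ^ 4 + 2 * X ^ 5) - (-X - 4 * X ^ 4 - X ^ 5) := by
    refine ⟨
      20 * X ^ 2 + 10 * X ^ 3 + 160 * X ^ 5 + 160 * X ^ 6 + 40 * X ^ 7 + 640 * X ^ 8 + 960 * X ^ 9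
      + 480 * X ^ 10 + 1360 * X ^ 11 + 2560 * X ^ 12 + 1920 * X ^ 13 + 1664 * X ^ 14 + 2640 * X ^
      15 + 2560 * X ^ 16 + 1280 * X ^ 17 + 320 * X ^ 18 + 32 * X ^ 19, ?_⟩
    simp only [thirdMap, add_comp, neg_comp, pow_comp, X_comp]
    ring
  simpa only [sub_add_sub_cancel] using dvd_add h1 h2

open Polynomial in
/-- The second iterate of any polynomial congruent to `-X - 4 X ^ 4 - X ^ 5` modulo `X ^ 6`
is congruent to `X + 2 X ^ 5`. -/
lemma X_pow_dvd_comp_self_sub {F : ℝ[X]} (hF : X ^ 6 ∣ F - (-X - 4 * X ^ 4 - X ^ 5)) :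
    X ^ 6 ∣ F.comp F - (X + C 2 * X ^ 5) := by
  have hX : X ∣ F := by
    have h1 : X ∣ F - (-X - 4 * X ^ 4 - X ^ 5) := (dvd_pow_self X (by norm_num)).trans hF
    have h2 : (X : ℝ[X]) ∣ -X - 4 * X ^ 4 - X ^ 5 := ⟨-1 - 4 * X ^ 3 - X ^ 4, by ring⟩
    simpa using dvd_add h1 h2
  have h1 := X_pow_dvd_sub_comp hF hX
  have h2 := X_pow_dvd_comp_sub_comp (-X - 4 * X ^ 4 - X ^ 5) hF
  have h3 : (X : ℝ[X]) ^ 6 ∣ (-X - 4 * X ^ 4 - X ^ 5 : ℝ[X]).comp (-X - 4 * X ^ 4 - X ^ 5) -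
      (X + C 2 * X ^ 5) := by
    refine ⟨
      -64 * X + 4 * X ^ 2 + 5 * X ^ 3 - 384 * X ^ 4 - 32 * X ^ 5 + 56 * X ^ 6 - 1014 * X ^ 7 - 128
      * X ^ 8 + 288 * X ^ 9 - 920 * X ^ 10 + 266 * X ^ 11 + 896 * X ^ 12 + 416 * X ^ 13 + 1100 * X
      ^ 14 + 1285 * X ^ 15 + 640 * X ^ 16 + 160 * X ^ 17 + 20 * X ^ 18 + X ^ 19, ?_⟩
    simp only [sub_comp, neg_comp, mul_comp, pow_comp, X_comp, ofNat_comp, map_ofNat]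
    ring
  simpa only [sub_add_sub_cancel] using dvd_add (dvd_add h1 h2) h3

lemma foldl_replicate_apply (h : ℝ → ℝ) (n : ℕ) (x : ℝ) :
    (List.replicate n h).foldl (fun y g => g y) x = h^[n] x := by
  induction n generalizing x with
  | zero => rfl
  | succ n ih => rw [List.replicate_succ, List.foldl_cons, ih, Function.iterate_succ_apply]

/-- for every `k ≥ 3` there are polynomial maps fixing `0`, with `0` LAS
for each of them, but a repeller for the composition. -/
theorem stmt2 (k : ℕ) (hk : 3 ≤ k) :
    ∃ f : Fin k → ℝ → ℝ,
      (∀ i, IsPolyMap (f i)) ∧ (∀ i, f i 0 = 0) ∧ (∀ i, IsLAS (f i) 0) ∧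
      IsRepeller (compAll f) 0 := by
  open Polynomial in
  obtain ⟨n, rfl⟩ := Nat.exists_eq_add_of_le' hk
  refine ⟨Fin.cons (fun x => firstMap.eval x) (Fin.cons (fun x => secondMap.eval x)
    (Fin.cons (fun x => thirdMap.eval x) fun _ : Fin n => fun x => x - x ^ 7)), ?_, ?_, ?_, ?_⟩
  · simp only [Fin.forall_fin_succ, Fin.cons_zero, Fin.cons_succ]
    exact ⟨⟨_, fun _ => rfl⟩, ⟨_, fun _ => rfl⟩, ⟨_, fun _ => rfl⟩,
      fun _ => ⟨X - X ^ 7, fun x => by simp⟩⟩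
  · simp [Fin.forall_fin_succ, firstMap, secondMap, thirdMap]
  · simp only [Fin.forall_fin_succ, Fin.cons_zero, Fin.cons_succ]
    exact ⟨isLAS_firstMap, isLAS_secondMap, isLAS_thirdMap, fun _ => isLAS_sub_pow_seven⟩
  · set T := thirdMap.comp (secondMap.comp firstMap)
    set H := (X - X ^ 7 : ℝ[X]).comp^[n] X
    have hX : X ∣ T := by
      rw [X_dvd_iff, coeff_zero_eq_eval_zero]
      simp [T, firstMap, secondMap, thirdMap]
    have hF : X ^ 6 ∣ H.comp T - (-X - 4 * X ^ 4 - X ^ 5) := by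
      have := X_pow_dvd_sub_comp (X_pow_dvd_iterate_comp_sub n) hX
      rw [X_comp] at this
      rw [← sub_add_sub_cancel _ T]
      exact dvd_add this X_pow_dvd_thirdMap_comp_comp
    convert isRepeller_eval_of_X_pow_dvd (X_pow_dvd_comp_self_sub hF) using 1
    funext x
    simp only [compAll, List.ofFn_succ, Fin.cons_zero, Fin.cons_succ, List.ofFn_const,
      List.foldl_cons, foldl_replicate_apply]
    simp only [H, T, eval_comp, iterate_comp_eval, eval_X]
    congr 2
    funext y
    simp
end

section
/- For every integer k ≥ 3 there exist polynomial maps f₁, f₂, …, f_k : ℝ → ℝ sharing the common fixed point 0, such that 0 is a repeller for each f_i, i = 1, …, k, and 0 is locally asymptotically stable (LAS) for the composition map f_k ∘ f_{k−1} ∘ ⋯ ∘ f₁. -/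
open Filter Topology

lemma exists_pos_le_on_annulus {g : ℝ → ℝ} (hg : Continuous g) {a b : ℝ}
    (hpos : ∀ y, a ≤ |y| → |y| ≤ b → 0 < g y) :
    ∃ c > 0, ∀ y, a ≤ |y| → |y| ≤ b → c ≤ g y := by
  have hK : IsCompact {y : ℝ | a ≤ |y| ∧ |y| ≤ b} := by
    refine (isCompact_closedBall (0 : ℝ) b).of_isClosed_subset
      ((isClosed_le continuous_const continuous_abs).inter
        (isClosed_le continuous_abs continuous_const)) fun y hy => ?_
    simpa using hy.2
  obtain ⟨c, hc, h⟩ := hK.exists_forall_le' hg.continuousOn (a := 0) fun y hy => hpos y hy.1 hy.2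
  exact ⟨c, hc, fun y h₁ h₂ => h y ⟨h₁, h₂⟩⟩

lemma exists_lt_abs_iterate_of_expanding {F : ℝ → ℝ} (hF : Continuous F) {ρ x : ℝ} (hx : x ≠ 0)
    (hexp : ∀ y, y ≠ 0 → |y| ≤ ρ → |y| < |F y|) : ∃ n : ℕ, ρ < |F^[n] x| := by
  by_contra! hcon
  have hx0 : 0 < |x| := abs_pos.2 hx
  obtain ⟨c, hc, hgap⟩ := exists_pos_le_on_annulus (g := fun y => |F y| - |y|) (a := |x|) (b := ρ)
    (by fun_prop) fun y h₁ h₂ => sub_pos.2 (hexp y (abs_pos.1 (hx0.trans_le h₁)) h₂)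
  have hgrow : ∀ n : ℕ, |x| + n * c ≤ |F^[n] x| := by
    intro n
    induction n with
    | zero => simp
    | succ n ih =>
      rw [Function.iterate_succ_apply']
      have := hgap _ ((le_add_of_nonneg_right (by positivity)).trans ih) (hcon n)
      push_cast
      linarith
  obtain ⟨n, hn⟩ := exists_nat_gt (ρ / c)
  rw [div_lt_iff₀ hc] at hn
  linarith [hgrow n, hcon n]

lemma exists_abs_iterate_lt_of_contracting {F : ℝ → ℝ} (hF : Continuous F) {ρ x δ : ℝ}
    (hδ : 0 < δ) (hx : |x| ≤ ρ) (hcontr : ∀ y, y ≠ 0 → |y| ≤ ρ → |F y| < |y|) :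
    ∃ n : ℕ, |F^[n] x| < δ := by
  by_contra! hcon
  obtain ⟨c, hc, hgap⟩ := exists_pos_le_on_annulus (g := fun y => |y| - |F y|) (a := δ) (b := ρ)
    (by fun_prop) fun y h₁ h₂ => sub_pos.2 (hcontr y (abs_pos.1 (hδ.trans_le h₁)) h₂)
  have hdecay : ∀ n : ℕ, |F^[n] x| ≤ ρ - n * c := by
    intro n
    induction n with
    | zero => simpa using hx
    | succ n ih =>
      rw [Function.iterate_succ_apply']
      have := hgap _ (hcon n) (ih.trans (sub_le_self _ (by positivity)))
      push_cast
      linarith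
  obtain ⟨n, hn⟩ := exists_nat_gt (ρ / c)
  rw [div_lt_iff₀ hc] at hn
  linarith [hdecay n, hcon n]

lemma iterate_two_mul_apply {α : Type*} (f : α → α) (n : ℕ) (x : α) :
    f^[2 * n] x = (fun y => f (f y))^[n] x := by
  rw [Function.iterate_mul]
  rfl

lemma isRepeller_zero_of_abs_lt_abs_sq {f : ℝ → ℝ} (hf : Continuous f) {r : ℝ} (hr : 0 < r)
    (h : ∀ y, y ≠ 0 → |y| < r → |y| < |f (f y)|) : IsRepeller f 0 := by
  refine ⟨r, hr, fun ε _ hεr x hx _ => ?_⟩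
  obtain ⟨n, hn⟩ := exists_lt_abs_iterate_of_expanding (F := fun y => f (f y)) (ρ := ε)
    (by fun_prop) hx fun y hy hyε => h y hy (hyε.trans_lt hεr)
  exact ⟨2 * n, by simpa [iterate_two_mul_apply] using hn⟩

lemma isLAS_zero_of_abs_sq_lt_abs {f : ℝ → ℝ} (hf : Continuous f) (h0 : f 0 = 0) {r : ℝ}
    (hr : 0 < r) (h : ∀ y, y ≠ 0 → |y| < r → |f (f y)| < |y|) : IsLAS f 0 := by
  have hle : ∀ y, |y| < r → |f (f y)| ≤ |y| := by
    intro y hy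
    rcases eq_or_ne y 0 with rfl | hy0
    · simp [h0]
    · exact (h y hy0 hy).le
  have stable : ∀ ε > 0, ∃ δ > 0, ∀ x : ℝ, |x| < δ → ∀ n : ℕ, |f^[n] x| < ε := by
    intro ε hε
    obtain ⟨δ, hδ, hfδ⟩ := Metric.continuousAt_iff.1 (hf.continuousAt (x := 0)) ε hε
    simp only [Real.dist_eq, sub_zero, h0] at hfδ
    refine ⟨min δ (min ε r), by positivity, fun x hx n => ?_⟩
    simp only [lt_min_iff] at hx
    have heven : ∀ m : ℕ, |f^[2 * m] x| ≤ |x| := by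
      intro m
      rw [iterate_two_mul_apply]
      induction m with
      | zero => simp
      | succ m ih =>
        rw [Function.iterate_succ_apply']
        exact (hle _ (ih.trans_lt hx.2.2)).trans ih
    obtain ⟨m, rfl | rfl⟩ := n.even_or_odd'
    · exact (heven m).trans_lt hx.2.1
    · rw [Function.iterate_succ_apply']
      exact hfδ ((heven m).trans_lt hx.1)
  refine ⟨fun ε hε => ?_, r, hr, fun x hx => ?_⟩
  · obtain ⟨δ, hδ, hs⟩ := stable ε hε
    exact ⟨δ, hδ, fun x hx n _ => by simpa using hs x (by simpa using hx) n⟩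
  · rw [sub_zero] at hx
    rw [Metric.tendsto_atTop]
    intro ε hε
    obtain ⟨δ, hδ, hs⟩ := stable ε hε
    obtain ⟨N, hN⟩ := exists_abs_iterate_lt_of_contracting (F := fun y => f (f y)) (by fun_prop)
      hδ le_rfl fun y hy hyx => h y hy (hyx.trans_lt hx)
    rw [← iterate_two_mul_apply] at hN
    refine ⟨2 * N, fun n hn => ?_⟩
    obtain ⟨m, rfl⟩ := Nat.exists_eq_add_of_le' hn
    simpa [Real.dist_eq, Function.iterate_add_apply] using hs _ hN m

lemma exists_abs_lt_abs_mul_one_add {p : ℝ → ℝ} (hp : Continuous p) (h0 : 0 < p 0) :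
    ∃ r > 0, ∀ y, y ≠ 0 → |y| < r → |y| < |y * (1 + y ^ 4 * p y)| := by
  obtain ⟨r, hr, h⟩ := Metric.eventually_nhds_iff.1 (hp.continuousAt.eventually_const_lt h0)
  refine ⟨r, hr, fun y hy hyr => ?_⟩
  have hpy : 0 < p y := h (by simpa [Real.dist_eq] using hyr)
  have hy4 : 0 < y ^ 4 * p y := by positivity
  rw [abs_mul, abs_of_pos (by linarith : 0 < 1 + y ^ 4 * p y)]
  exact lt_mul_of_one_lt_right (abs_pos.2 hy) (by linarith)

lemma exists_abs_mul_one_add_lt_abs {p : ℝ → ℝ} (hp : Continuous p) (h0 : p 0 < 0) :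
    ∃ r > 0, ∀ y, y ≠ 0 → |y| < r → |y * (1 + y ^ 4 * p y)| < |y| := by
  have hcont : ContinuousAt (fun y => y ^ 4 * p y) 0 := by fun_prop
  have hlow : ∀ᶠ y in 𝓝 (0 : ℝ), -1 < y ^ 4 * p y := hcont.eventually_const_lt (by simp)
  obtain ⟨r, hr, h⟩ :=
    Metric.eventually_nhds_iff.1 ((hp.continuousAt.eventually_lt_const h0).and hlow)
  refine ⟨r, hr, fun y hy hyr => ?_⟩
  obtain ⟨hpy, hlo⟩ := h (by simpa [Real.dist_eq] using hyr : dist y 0 < r)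
  have hy4 : y ^ 4 * p y < 0 := mul_neg_of_pos_of_neg (by positivity) hpy
  rw [abs_mul, abs_of_pos (by linarith : 0 < 1 + y ^ 4 * p y)]
  exact mul_lt_of_lt_one_right (abs_pos.2 hy) (by linarith)

lemma isRepeller_zero_of_sq_eq {f p : ℝ → ℝ} (hf : Continuous f) (hp : Continuous p)
    (h0 : 0 < p 0) (h : ∀ x, f (f x) = x * (1 + x ^ 4 * p x)) : IsRepeller f 0 := by
  obtain ⟨r, hr, hlt⟩ := exists_abs_lt_abs_mul_one_add hp h0
  exact isRepeller_zero_of_abs_lt_abs_sq hf hr fun y hy hyr => (h y).symm ▸ hlt y hy hyr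

lemma isLAS_zero_of_sq_eq {f p : ℝ → ℝ} (hf : Continuous f) (hf0 : f 0 = 0) (hp : Continuous p)
    (h0 : p 0 < 0) (h : ∀ x, f (f x) = x * (1 + x ^ 4 * p x)) : IsLAS f 0 := by
  obtain ⟨r, hr, hlt⟩ := exists_abs_mul_one_add_lt_abs hp h0
  exact isLAS_zero_of_abs_sq_lt_abs hf hf0 hr fun y hy hyr => (h y).symm ▸ hlt y hy hyr

/-- An orientation-reversing repeller. -/
def oddReversing (x : ℝ) : ℝ := -x - x ^ 5

/-- An orientation-reversing repeller with a quartic term. -/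
def quarticReversing (x : ℝ) : ℝ := -x - 4 * x ^ 4 - x ^ 5

/-- An orientation-reversing repeller with a quadratic term. -/
def quadraticReversing (x : ℝ) : ℝ := -x + x ^ 2 - x ^ 3 + x ^ 5

/-- An orientation-preserving repeller tangent to the identity to high order. -/
def septicPreserving (x : ℝ) : ℝ := x + x ^ 7

/-- The fifth-order Taylor polynomial at `0` of
`quadraticReversing ∘ quarticReversing ∘ oddReversing`. -/
def compJet (x : ℝ) : ℝ := -x + x ^ 2 - x ^ 3 + 4 * x ^ 4 - 9 * x ^ 5

/-- `h` agrees with `compJet` up to a continuous multiple of `x ^ 6`. -/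
def HasCompJet (h : ℝ → ℝ) : Prop :=
  ∃ q : ℝ → ℝ, Continuous q ∧ ∀ x, h x = compJet x + x ^ 6 * q x

lemma isRepeller_oddReversing : IsRepeller oddReversing 0 := by
  refine isRepeller_zero_of_sq_eq (p := fun x => 1 + (1 + x ^ 4) ^ 5)
    (by unfold oddReversing; fun_prop) (by fun_prop) (by norm_num) fun x => ?_
  simp only [oddReversing]
  ring

lemma isRepeller_septicPreserving : IsRepeller septicPreserving 0 := by
  have key : ∀ y, y ≠ 0 → |y| < |septicPreserving y| := by
    intro y hy
    have hy6 : 0 < y ^ 6 := by positivity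
    rw [septicPreserving, show y + y ^ 7 = y * (1 + y ^ 6) by ring, abs_mul,
      abs_of_pos (by linarith : 0 < 1 + y ^ 6)]
    exact lt_mul_of_one_lt_right (abs_pos.2 hy) (by linarith)
  refine isRepeller_zero_of_abs_lt_abs_sq (by unfold septicPreserving; fun_prop) one_pos
    fun y hy _ => (key y hy).trans (key _ ?_)
  exact abs_pos.1 ((abs_pos.2 hy).trans (key y hy))

lemma isRepeller_quarticReversing : IsRepeller quarticReversing 0 := by
  refine isRepeller_zero_of_sq_eq
    (p := fun x => 2 - 64 * x ^ 2 + 4 * x ^ 3 + 5 * x ^ 4 - 384 * x ^ 5 - 32 * x ^ 6 + 56 * x ^ 7 - 1014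
        * x ^ 8 - 128 * x ^ 9 + 288 * x ^ 10 - 920 * x ^ 11 + 266 * x ^ 12 + 896 * x ^ 13 +
        416 * x ^ 14 + 1100 * x ^ 15 + 1285 * x ^ 16 + 640 * x ^ 17 + 160 * x ^ 18 + 20 * x ^
        19 + x ^ 20)
    (by unfold quarticReversing; fun_prop) (by fun_prop) (by norm_num) fun x => ?_
  simp only [quarticReversing]
  ring

lemma isRepeller_quadraticReversing : IsRepeller quadraticReversing 0 := by
  refine isRepeller_zero_of_sq_eq
    (p := fun x => 2 - 3 * x - 10 * x ^ 2 + 31 * x ^ 3 - 48 * x ^ 4 + 38 * x ^ 5 + 5 * x ^ 6 - 53 * x ^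
        7 + 73 * x ^ 8 - 45 * x ^ 9 - 12 * x ^ 10 + 50 * x ^ 11 - 45 * x ^ 12 + 10 * x ^ 13 +
        20 * x ^ 14 - 20 * x ^ 15 + 5 * x ^ 16 + 5 * x ^ 17 - 5 * x ^ 18 + x ^ 20)
    (by unfold quadraticReversing; fun_prop) (by fun_prop) (by norm_num) fun x => ?_
  simp only [quadraticReversing]
  ring

lemma quarticReversing_oddReversing (x : ℝ) :
    quarticReversing (oddReversing x) = x - 4 * x ^ 4 + 2 * x ^ 5 + x ^ 6 *
      (-16 * x ^ 2 + 5 * x ^ 3 - 24 * x ^ 6 + 10 * x ^ 7 - 16 * x ^ 10 + 10 * x ^ 11 - 4 * x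
        ^ 14 + 5 * x ^ 15 + x ^ 19) := by
  simp only [quarticReversing, oddReversing]
  ring

lemma quadraticReversing_quintic (x : ℝ) :
    quadraticReversing (x - 4 * x ^ 4 + 2 * x ^ 5) = compJet x + x ^ 6 *
      (16 - 6 * x - 4 * x ^ 2 - 54 * x ^ 3 + 52 * x ^ 4 + 148 * x ^ 5 - 96 * x ^ 6 - 56 * x
        ^ 7 - 592 * x ^ 8 + 952 * x ^ 9 - 480 * x ^ 10 + 1360 * x ^ 11 - 2560 * x ^ 12 + 1920
        * x ^ 13 - 1664 * x ^ 14 + 2640 * x ^ 15 - 2560 * x ^ 16 + 1280 * x ^ 17 - 320 * x ^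
        18 + 32 * x ^ 19) := by
  simp only [quadraticReversing, compJet]
  ring

lemma quadraticReversing_add (v w : ℝ) :
    quadraticReversing (v + w) = quadraticReversing v + w *
      (-1 + (2 * v + w) - ((v + w) ^ 2 + (v + w) * v + v ^ 2) +
        ((v + w) ^ 4 + (v + w) ^ 3 * v + (v + w) ^ 2 * v ^ 2 + (v + w) * v ^ 3 + v ^ 4)) := by
  simp only [quadraticReversing]
  ring

lemma compJet_add (v w : ℝ) :
    compJet (v + w) = compJet v + w *
      (-1 + (2 * v + w) - ((v + w) ^ 2 + (v + w) * v + v ^ 2) +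
        4 * ((v + w) ^ 3 + (v + w) ^ 2 * v + (v + w) * v ^ 2 + v ^ 3) -
        9 * ((v + w) ^ 4 + (v + w) ^ 3 * v + (v + w) ^ 2 * v ^ 2 + (v + w) * v ^ 3 + v ^ 4)) := by
  simp only [compJet]
  ring

lemma compJet_compJet (x : ℝ) :
    compJet (compJet x) = x - 2 * x ^ 5 + x ^ 6 *
      (3 + 38 * x - 97 * x ^ 2 + 732 * x ^ 3 - 2392 * x ^ 4 + 5405 * x ^ 5 - 13881 * x ^ 6 +
        35395 * x ^ 7 - 68135 * x ^ 8 + 124544 * x ^ 9 - 241454 * x ^ 10 + 408843 * x ^ 11 -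
        577962 * x ^ 12 + 836424 * x ^ 13 - 1180152 * x ^ 14 + 1339335 * x ^ 15 - 1286685 * x
        ^ 16 + 1345005 * x ^ 17 - 1180980 * x ^ 18 + 531441 * x ^ 19) := by
  simp only [compJet]
  ring

lemma continuous_compJet : Continuous compJet := by
  unfold compJet
  fun_prop

lemma hasCompJet_comp :
    HasCompJet fun x => quadraticReversing (quarticReversing (oddReversing x)) := by
  refine ⟨?_, ?_, fun x => ?_⟩
  rotate_left 2
  · beta_reduce
    rw [quarticReversing_oddReversing, quadraticReversing_add, quadraticReversing_quintic,
      add_assoc, mul_assoc, ← mul_add]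
  · fun_prop

lemma HasCompJet.septicPreserving_comp {h : ℝ → ℝ} (hh : HasCompJet h) :
    HasCompJet fun x => septicPreserving (h x) := by
  obtain ⟨q, hq, h_eq⟩ := hh
  refine ⟨fun x => q x + x * (-1 + x - x ^ 2 + 4 * x ^ 3 - 9 * x ^ 4 + x ^ 5 * q x) ^ 7,
    by fun_prop, fun x => ?_⟩
  simp only [h_eq, septicPreserving, compJet]
  ring

lemma HasCompJet.isLAS {h : ℝ → ℝ} (hh : HasCompJet h) : IsLAS h 0 := by
  obtain ⟨q, hq, h_eq⟩ := hh
  have hcont : Continuous h := by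
    rw [funext h_eq]
    exact continuous_compJet.add (by fun_prop)
  have hfactor : ∀ x, h x = x * (-1 + x - x ^ 2 + 4 * x ^ 3 - 9 * x ^ 4 + x ^ 5 * q x) := by
    intro x
    rw [h_eq, compJet]
    ring
  obtain ⟨s, hs, hs_eq⟩ : ∃ s : ℝ → ℝ, Continuous s ∧
      ∀ x, compJet (compJet x + x ^ 6 * q x) = x - 2 * x ^ 5 + x ^ 6 * s x := by
    refine ⟨?_, ?_, fun x => ?_⟩
    rotate_left 2
    · rw [compJet_add, compJet_compJet, add_assoc, mul_assoc, ← mul_add]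
    · have := continuous_compJet
      fun_prop
  refine isLAS_zero_of_sq_eq
    (p := fun x => -2 + x * (s x +
      (-1 + x - x ^ 2 + 4 * x ^ 3 - 9 * x ^ 4 + x ^ 5 * q x) ^ 6 * q (h x)))
    hcont (by simp [hfactor]) (by fun_prop) (by norm_num) fun x => ?_
  rw [h_eq (h x)]
  nth_rw 1 [h_eq x]
  rw [hs_eq]
  nth_rw 1 [hfactor x]
  ring

lemma hasCompJet_foldl_replicate (n : ℕ) {h : ℝ → ℝ} (hh : HasCompJet h) :
    HasCompJet fun x => (List.replicate n septicPreserving).foldl (fun y g => g y) (h x) := by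
  induction n generalizing h with
  | zero => simpa using hh
  | succ n ih => simpa [List.replicate_succ] using ih hh.septicPreserving_comp

/-- for every `k ≥ 3` there are polynomial maps fixing `0`, with `0` a
repeller for each of them, but LAS for the composition. -/
theorem stmt3 (k : ℕ) (hk : 3 ≤ k) :
    ∃ f : Fin k → ℝ → ℝ,
      (∀ i, IsPolyMap (f i)) ∧ (∀ i, f i 0 = 0) ∧ (∀ i, IsRepeller (f i) 0) ∧
      IsLAS (compAll f) 0 := by
  obtain ⟨n, rfl⟩ := Nat.exists_eq_add_of_le' hk
  refine ⟨Fin.cons oddReversing (Fin.cons quarticReversing (Fin.cons quadraticReversing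
    fun _ : Fin n => septicPreserving)), ?_, ?_, ?_, ?_⟩
  · simp only [Fin.forall_fin_succ, Fin.cons_zero, Fin.cons_succ]
    exact ⟨⟨-.X - .X ^ 5, by simp [oddReversing]⟩, ⟨-.X - 4 * .X ^ 4 - .X ^ 5, by simp [quarticReversing]⟩,
      ⟨-.X + .X ^ 2 - .X ^ 3 + .X ^ 5, by simp [quadraticReversing]⟩,
      fun _ => ⟨.X + .X ^ 7, by simp [septicPreserving]⟩⟩
  · simp [Fin.forall_fin_succ, oddReversing, quarticReversing, quadraticReversing,
      septicPreserving]
  · simp only [Fin.forall_fin_succ, Fin.cons_zero, Fin.cons_succ]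
    exact ⟨isRepeller_oddReversing, isRepeller_quarticReversing, isRepeller_quadraticReversing,
      fun _ => isRepeller_septicPreserving⟩
  · have := (hasCompJet_foldl_replicate n hasCompJet_comp).isLAS
    unfold compAll
    simpa [List.ofFn_succ, List.ofFn_const] using this
end

section
/- Let U ⊆ ℝ be a neighborhood of 0 and let f : U → ℝ be a map of class C^{m+1} with f(0) = 0, f'(0) = 1, whose Taylor expansion at 0 is f(x) = x + a_m x^m + O(x^{m+1}) with a_m ≠ 0 and m ≥ 2 even. Then the origin is semi-asymptotically stable from the left if a_m > 0, and semi-asymptotically stable from the right if a_m < 0. -/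
open Filter Topology

/-- A bounded orbit that stays in an interval where `f` does not decrease points and is continuous
converges to a fixed point of `f`. -/
theorem exists_tendsto_iterate_of_le_map {f : ℝ → ℝ} {a b x : ℝ}
    (hc : ∀ y ∈ Set.Icc a b, ContinuousAt f y) (hle : ∀ y ∈ Set.Icc a b, y ≤ f y)
    (horb : ∀ n : ℕ, f^[n] x ∈ Set.Icc a b) :
    ∃ y ∈ Set.Icc x b, f y = y ∧ Tendsto (fun n => f^[n] x) atTop (𝓝 y) := by
  have hmono : Monotone (fun n => f^[n] x) := by
    refine monotone_nat_of_le_succ fun n => ?_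
    rw [Function.iterate_succ_apply']
    exact hle _ (horb n)
  have hbdd : BddAbove (Set.range fun n => f^[n] x) := by
    refine ⟨b, ?_⟩
    rintro _ ⟨n, rfl⟩
    exact (horb n).2
  have hlim := tendsto_atTop_ciSup hmono hbdd
  set y := ⨆ n, f^[n] x
  have hxy : x ≤ y := hmono.ge_of_tendsto hlim 0
  have hyb : y ≤ b := le_of_tendsto' hlim fun n => (horb n).2
  have hax : a ≤ x := (horb 0).1
  exact ⟨y, ⟨hxy, hyb⟩, isFixedPt_of_tendsto_iterate hlim (hc y ⟨hax.trans hxy, hyb⟩), hlim⟩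

/-- If `f` moves nearby points to the right, and does not push nearby negative points past `0`,
then `0` is semi-asymptotically stable from the left. -/
theorem isSemiASLeft_zero_of_eventually {f : ℝ → ℝ} (hc : ∀ᶠ x in 𝓝 0, ContinuousAt f x)
    (hlt : ∀ᶠ x in 𝓝 0, x ≠ 0 → x < f x) (hneg : ∀ᶠ x in 𝓝 0, x < 0 → f x < 0) :
    IsSemiASLeft f 0 := by
  obtain ⟨ρ, hρ, hball⟩ := Metric.eventually_nhds_iff.1 (hc.and (hlt.and hneg))
  have H : ∀ x, |x| < ρ → ContinuousAt f x ∧ (x ≠ 0 → x < f x) ∧ (x < 0 → f x < 0) :=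
    fun x hx => hball (by simpa [Real.dist_eq] using hx)
  have horb : ∀ x, -ρ < x → x < 0 → ∀ n : ℕ, x ≤ f^[n] x ∧ f^[n] x < 0 := by
    intro x hx hx0 n
    induction n with
    | zero => exact ⟨le_rfl, hx0⟩
    | succ n ih =>
      rw [Function.iterate_succ_apply']
      obtain ⟨-, h1, h2⟩ := H (f^[n] x) (abs_lt.2 ⟨by linarith, by linarith⟩)
      exact ⟨ih.1.trans (h1 ih.2.ne).le, h2 ih.2⟩
  refine ⟨fun ε hε => ⟨min ε ρ, lt_min hε hρ, ?_⟩, ⟨ρ, hρ, ?_⟩, ⟨ρ / 2, half_pos hρ, ?_⟩⟩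
  · rintro x ⟨hx, hx0⟩ n -
    have := min_le_left ε ρ
    have := min_le_right ε ρ
    obtain ⟨h1, h2⟩ := horb x (by linarith) hx0 n
    rw [sub_zero, abs_lt]
    constructor <;> linarith
  · rintro x ⟨hx, hx0⟩
    have hx' : -ρ < x := by linarith
    have hI : ∀ y ∈ Set.Icc x 0, |y| < ρ := fun y hy =>
      abs_lt.2 ⟨hx'.trans_le hy.1, hy.2.trans_lt hρ⟩
    have hf0 : 0 ≤ f 0 := by
      have hc0 : ContinuousAt f 0 := (H 0 (by simpa using hρ)).1
      refine le_of_tendsto_of_tendsto (b := 𝓝[≠] (0 : ℝ)) (f := id)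
        (continuousAt_id.tendsto.mono_left nhdsWithin_le_nhds)
        (hc0.tendsto.mono_left nhdsWithin_le_nhds) ?_
      filter_upwards [nhdsWithin_le_nhds hlt, self_mem_nhdsWithin] with y hy hy0
      exact (hy hy0).le
    obtain ⟨y, hy, hfix, hlim⟩ := exists_tendsto_iterate_of_le_map (f := f) (a := x) (b := 0)
      (fun y hy => (H y (hI y hy)).1)
      (fun y hy => by
        rcases eq_or_ne y 0 with rfl | h
        · exact hf0
        · exact ((H y (hI y hy)).2.1 h).le)
      (fun n => ⟨(horb x hx' hx0 n).1, (horb x hx' hx0 n).2.le⟩)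
    have : y = 0 := by
      by_contra h
      exact absurd hfix ((H y (hI y hy)).2.1 h).ne'
    rwa [this] at hlim
  · rintro x ⟨hx0, hx⟩
    by_contra! hcon
    have hI : ∀ y ∈ Set.Icc x (ρ / 2), |y| < ρ := fun y hy =>
      abs_lt.2 ⟨by linarith [hy.1], by linarith [hy.2]⟩
    have hlt' : ∀ y ∈ Set.Icc x (ρ / 2), y < f y := fun y hy =>
      (H y (hI y hy)).2.1 (hx0.trans_le hy.1).ne'
    have hmem : ∀ n : ℕ, f^[n] x ∈ Set.Icc x (ρ / 2) := by
      intro n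
      have hb : ∀ n, f^[n] x ≤ ρ / 2 := fun n => by
        simpa using (le_abs_self _).trans (hcon n)
      refine ⟨?_, hb n⟩
      induction n with
      | zero => exact le_rfl
      | succ n ih =>
        rw [Function.iterate_succ_apply']
        exact ih.trans (hlt' _ ⟨ih, hb n⟩).le
    obtain ⟨y, hy, hfix, -⟩ := exists_tendsto_iterate_of_le_map
      (fun y hy => (H y (hI y hy)).1) (fun y hy => (hlt' y hy).le) hmem
    exact absurd hfix (hlt' y hy).ne'

/-- Conjugation by `x ↦ -x` exchanges the two sides of the fixed point `0`. -/
theorem IsSemiASLeft.isSemiASRight_of_conj_neg {f : ℝ → ℝ}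
    (h : IsSemiASLeft (fun x => -f (-x)) 0) : IsSemiASRight f 0 := by
  have hit : ∀ (n : ℕ) (x : ℝ), (fun x => -f (-x))^[n] (-x) = -f^[n] x := fun n x =>
    ((Function.Semiconj.iterate_right (f := fun x : ℝ => -x) (ga := f)
      (gb := fun x => -f (-x)) (fun x => by simp) n) x).symm
  obtain ⟨h1, ⟨η, hη, h2⟩, ⟨θ, hθ, h3⟩⟩ := h
  refine ⟨fun ε hε => ?_, ⟨η, hη, fun x hx => ?_⟩, ⟨θ, hθ, fun x hx => ?_⟩⟩
  · obtain ⟨δ, hδ, h1⟩ := h1 ε hε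
    refine ⟨δ, hδ, fun x hx n hn => ?_⟩
    have := h1 (-x) ⟨by linarith [hx.2], by linarith [hx.1]⟩ n hn
    rwa [hit, sub_zero, abs_neg, ← sub_zero (f^[n] x)] at this
  · have := h2 (-x) ⟨by linarith [hx.2], by linarith [hx.1]⟩
    simp only [hit] at this
    simpa using this.neg
  · obtain ⟨n, hn⟩ := h3 (-x) ⟨by linarith [hx.2], by linarith [hx.1]⟩
    refine ⟨n, ?_⟩
    rwa [hit, sub_zero, abs_neg, ← sub_zero (f^[n] x)] at hn

/-- Taylor's theorem at `0` for a map tangent to the identity whose intermediate derivatives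
vanish. -/
theorem isLittleO_sub_id_sub_of_iteratedDeriv_eq_zero {U : Set ℝ} (hU : U ∈ 𝓝 (0 : ℝ)) {m : ℕ}
    (hm : 2 ≤ m) {f : ℝ → ℝ} (hreg : ContDiffOn ℝ m f U) (hf0 : f 0 = 0) (hf1 : deriv f 0 = 1)
    (hvanish : ∀ j, 2 ≤ j → j < m → iteratedDeriv j f 0 = 0) :
    (fun x => f x - x - iteratedDeriv m f 0 / (Nat.factorial m) * x ^ m) =o[𝓝 0]
      fun x => x ^ m := by
  obtain ⟨r, hr, hrU⟩ := Metric.mem_nhds_iff.1 hU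
  have h0 : (0 : ℝ) ∈ Metric.ball (0 : ℝ) r := Metric.mem_ball_self hr
  have hT := taylor_isLittleO (convex_ball (0 : ℝ) r) h0 (hreg.mono hrU)
  rw [Metric.isOpen_ball.nhdsWithin_eq h0] at hT
  obtain ⟨k, rfl⟩ := Nat.exists_eq_add_of_le' hm
  refine hT.congr (fun x => ?_) (fun x => by rw [sub_zero])
  have hmid : ∑ j ∈ Finset.range k, ((Nat.factorial (j + 1 + 1) : ℝ)⁻¹ * x ^ (j + 1 + 1)) *
      iteratedDeriv (j + 1 + 1) f 0 = 0 :=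
    Finset.sum_eq_zero fun j hj => by
      rw [hvanish (j + 1 + 1) (by omega) (by have := Finset.mem_range.1 hj; omega), mul_zero]
  rw [taylor_within_apply]
  simp only [iteratedDerivWithin_of_isOpen Metric.isOpen_ball h0, sub_zero, smul_eq_mul]
  rw [Finset.sum_range_succ, Finset.sum_range_succ', Finset.sum_range_succ', hmid]
  simp [hf0, hf1]
  ring

/-- for a `C^{m+1}` map with `f(0)=0`, `f'(0)=1` and Taylor expansion
`f(x) = x + aₘ xᵐ + O(x^{m+1})`, `aₘ ≠ 0`, `m ≥ 2` even, the origin is semi-AS from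
the left if `aₘ > 0` and semi-AS from the right if `aₘ < 0`. -/
theorem stmt8 (U : Set ℝ) (hU : U ∈ 𝓝 (0 : ℝ)) (m : ℕ) (hm : 2 ≤ m) (hmeven : Even m)
    (f : ℝ → ℝ) (hreg : ContDiffOn ℝ (m + 1) f U)
    (hf0 : f 0 = 0) (hf1 : deriv f 0 = 1)
    (hvanish : ∀ j, 2 ≤ j → j < m → iteratedDeriv j f 0 = 0)
    (am : ℝ) (ham : am = iteratedDeriv m f 0 / (Nat.factorial m)) (hne : am ≠ 0) :
    (0 < am → IsSemiASLeft f 0) ∧ (am < 0 → IsSemiASRight f 0) := by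
  have hc : ∀ᶠ x in 𝓝 0, ContinuousAt f x := by
    filter_upwards [eventually_mem_nhds_iff.2 hU] with x hx
    exact hreg.continuousOn.continuousAt hx
  have hT := isLittleO_sub_id_sub_of_iteratedDeriv_eq_zero hU hm
    (hreg.of_le (by exact_mod_cast Nat.le_succ m)) hf0 hf1 hvanish
  rw [← ham] at hT
  have hmove : ∀ᶠ x in 𝓝 0, x ≠ 0 → 0 < am * (f x - x) := by
    filter_upwards [hT.bound (half_pos (abs_pos.2 hne))] with x hx hx0
    have hp : 0 < x ^ m := hmeven.pow_pos hx0
    rw [Real.norm_eq_abs, Real.norm_eq_abs, abs_of_pos hp] at hx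
    have h1 : |am * (f x - x - am * x ^ m)| ≤ am ^ 2 / 2 * x ^ m := by
      rw [abs_mul]
      calc |am| * |f x - x - am * x ^ m| ≤ |am| * (|am| / 2 * x ^ m) := by gcongr
        _ = am ^ 2 / 2 * x ^ m := by rw [← sq_abs am]; ring
    have h2 : 0 < am ^ 2 / 2 * x ^ m := by positivity
    linarith [(abs_le.1 h1).1]
  have hsign : ∀ᶠ x in 𝓝 0, x ≠ 0 → 0 < x * f x := by
    have hd : HasDerivAt f 1 0 := by
      rw [← hf1]
      exact (differentiableAt_of_deriv_ne_zero (by simp [hf1])).hasDerivAt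
    filter_upwards [(hasDerivAt_iff_isLittleO.1 hd).bound (half_pos one_pos)] with x hx hx0
    simp only [hf0, sub_zero, smul_eq_mul, mul_one, Real.norm_eq_abs] at hx
    have h1 : |x * (f x - x)| ≤ x ^ 2 / 2 := by
      rw [abs_mul]
      calc |x| * |f x - x| ≤ |x| * (1 / 2 * |x|) := by gcongr
        _ = x ^ 2 / 2 := by rw [← sq_abs x]; ring
    have h2 : 0 < x ^ 2 := by positivity
    linarith [(abs_le.1 h1).1]
  have hneg : Tendsto (fun x : ℝ => -x) (𝓝 0) (𝓝 0) := by
    simpa using (continuous_neg (G := ℝ)).tendsto 0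
  refine ⟨fun ha => isSemiASLeft_zero_of_eventually hc ?_ ?_,
    fun ha => (isSemiASLeft_zero_of_eventually ?_ ?_ ?_).isSemiASRight_of_conj_neg⟩
  · filter_upwards [hmove] with x hx hx0
    exact sub_pos.1 (pos_of_mul_pos_right (hx hx0) ha.le)
  · filter_upwards [hsign] with x hx hx0
    exact neg_of_mul_pos_right (hx hx0.ne) hx0.le
  · filter_upwards [hneg.eventually hc] with x hx
    exact (ContinuousAt.comp (f := fun x : ℝ => -x) hx continuousAt_neg).neg
  · filter_upwards [hneg.eventually hmove] with x hx hx0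
    have := neg_of_mul_pos_right (hx (neg_ne_zero.2 hx0)) ha.le
    linarith
  · filter_upwards [hneg.eventually hsign] with x hx hx0
    exact neg_neg_of_pos (pos_of_mul_pos_right (hx (neg_ne_zero.2 hx0.ne)) (neg_pos.2 hx0).le)
end

section
/- Let f be a real-analytic map on a neighborhood U ⊆ ℝ of 0 with f(0) = 0 and f'(0) = −1, and suppose f is not an involution (f ∘ f is not the identity near 0). Then the smallest integer j ≥ 2 such that the j-th Taylor coefficient at 0 of f ∘ f − id is nonzero exists and is odd; that is, there exists m ≥ 1 and V ≠ 0 such that f(f(x)) = x + V x^{2m+1} + O(x^{2m+2}). -/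
open Filter Topology

/-- If `f` fixes `0` with `f' 0 = -1`, and `f (f x) - x` is `x ^ n * h x` near `0` with `h`
continuous and nonzero at `0`, then `n` is odd. -/
lemma odd_of_comp_self_sub_id_eq_pow_mul {f h : ℝ → ℝ} {n : ℕ} (hf : HasStrictDerivAt f (-1) 0)
    (hf0 : f 0 = 0) (hh : ContinuousAt h 0) (hh0 : h 0 ≠ 0)
    (hfh : ∀ᶠ x in 𝓝 (0 : ℝ), f (f x) - x = x ^ n * h x) : Odd n := by
  have hf_lim : Tendsto f (𝓝 0) (𝓝 0) := by simpa [hf0] using hf.hasDerivAt.continuousAt.tendsto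
  have h_pair : Tendsto (fun x ↦ (f (f x), x)) (𝓝 0) (𝓝 ((0 : ℝ), (0 : ℝ))) := by
    rw [nhds_prod_eq]
    exact (hf_lim.comp hf_lim).prodMk tendsto_id
  have h_small : (fun x ↦ x ^ n * h x + f x ^ n * h (f x)) =o[𝓝 0] fun x ↦ x ^ n := by
    have h_bound : (fun x ↦ x ^ n * h x) =O[𝓝 0] fun x ↦ x ^ n := by
      simpa using (Asymptotics.isBigO_refl (fun x : ℝ ↦ x ^ n) (𝓝 0)).mul (hh.isBigO_one ℝ)
    refine Asymptotics.IsLittleO.trans_isBigO ?_ h_bound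
    refine (hf.isLittleO.comp_tendsto h_pair).congr' ?_ hfh
    filter_upwards [hfh, hf_lim.eventually hfh] with x hx hfx
    simp only [Function.comp_apply, ContinuousLinearMap.toSpanSingleton_apply, smul_eq_mul]
    rw [← hx, ← hfx]
    ring
  have h_slope : Tendsto (fun x ↦ f x / x) (𝓝[≠] 0) (𝓝 (-1)) := by
    have := hasDerivAt_iff_tendsto_slope.mp hf.hasDerivAt
    refine this.congr fun x ↦ ?_
    simp [slope_def_field, hf0]
  have h_lim : Tendsto (fun x ↦ h x + (f x / x) ^ n * h (f x)) (𝓝[≠] 0)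
      (𝓝 (h 0 + (-1) ^ n * h 0)) :=
    (hh.tendsto.mono_left nhdsWithin_le_nhds).add
      ((h_slope.pow n).mul ((hh.tendsto.comp hf_lim).mono_left nhdsWithin_le_nhds))
  have h_zero : Tendsto (fun x ↦ h x + (f x / x) ^ n * h (f x)) (𝓝[≠] 0) (𝓝 0) := by
    refine (h_small.tendsto_div_nhds_zero.mono_left nhdsWithin_le_nhds).congr' ?_
    filter_upwards [self_mem_nhdsWithin] with x hx
    have hx : x ≠ 0 := hx
    rw [div_pow]
    field_simp
  have h_eq := tendsto_nhds_unique h_lim h_zero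
  by_contra hn
  rw [(Nat.not_odd_iff_even.mp hn).neg_one_pow] at h_eq
  exact hh0 (by linarith)

/-- for an analytic map on a neighborhood of `0` with `f(0)=0`,
`f'(0)=-1`, which is not an involution, the first nonzero Taylor coefficient of
`f ∘ f - id` at `0` has odd order: there are `m ≥ 1` and `V ≠ 0` with
`f(f(x)) = x + V x^{2m+1} + O(x^{2m+2})`. -/
theorem stmt10 (U : Set ℝ) (hU : U ∈ 𝓝 (0 : ℝ)) (f : ℝ → ℝ)
    (hf : AnalyticOnNhd ℝ f U) (hf0 : f 0 = 0) (hf1 : deriv f 0 = -1)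
    (hnoninv : ¬ ∀ᶠ x in 𝓝 (0 : ℝ), f (f x) = x) :
    ∃ m : ℕ, 1 ≤ m ∧ ∃ V : ℝ, V ≠ 0 ∧
      (∀ j, 2 ≤ j → j ≤ 2 * m → iteratedDeriv j (f ∘ f) 0 = 0) ∧
      iteratedDeriv (2 * m + 1) (f ∘ f) 0 / (Nat.factorial (2 * m + 1)) = V := by
  have hfa : AnalyticAt ℝ f 0 := hf 0 (mem_of_mem_nhds hU)
  have hfs : HasStrictDerivAt f (-1) 0 := hf1 ▸ hfa.hasStrictDerivAt
  have hff : AnalyticAt ℝ (f ∘ f) 0 := AnalyticAt.comp (by rwa [hf0]) hfa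
  have hg : AnalyticAt ℝ (f ∘ f - id) 0 := hff.sub analyticAt_id
  have h_top : analyticOrderAt (f ∘ f - id) 0 ≠ ⊤ := by
    simpa [analyticOrderAt_eq_top, sub_eq_zero] using hnoninv
  obtain ⟨n, hn⟩ := ENat.ne_top_iff_exists.mp h_top
  obtain ⟨h, hh, hh0, hfh⟩ := hg.analyticOrderAt_eq_natCast.mp hn.symm
  have h_odd : Odd n := odd_of_comp_self_sub_id_eq_pow_mul hfs hf0 hh.continuousAt hh0
    (by simpa using hfh)
  obtain ⟨h_lt, h_ne⟩ := (analyticOrderAt_eq_nat_iff_iteratedDeriv_eq_zero hg).mp hn.symm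
  have h_iter (j : ℕ) (hj : 2 ≤ j) :
      iteratedDeriv j (f ∘ f - id) 0 = iteratedDeriv j (f ∘ f) 0 := by
    rw [iteratedDeriv_sub hff.contDiffAt analyticAt_id.contDiffAt, iteratedDeriv_id]
    simp [show j ≠ 0 by lia, show j ≠ 1 by lia]
  have h_one : iteratedDeriv 1 (f ∘ f - id) 0 = 0 := by
    have hd : HasDerivAt (f ∘ f) (-1 * -1) 0 :=
      HasDerivAt.comp 0 (by rw [hf0]; exact hfs.hasDerivAt) hfs.hasDerivAt
    rw [iteratedDeriv_one, (hd.sub (hasDerivAt_id 0)).deriv]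
    norm_num
  obtain ⟨m, rfl⟩ := h_odd
  have hm : 1 ≤ m := by
    by_contra! hm
    obtain rfl : m = 0 := by lia
    exact h_ne h_one
  refine ⟨m, hm, _, ?_, fun j hj hjm ↦ ?_, rfl⟩
  · rw [← h_iter _ (by lia)]
    exact div_ne_zero h_ne (by positivity)
  · rw [← h_iter j hj]
    exact h_lt j (by lia)
end

section
/- Let f be a real-analytic map on a neighborhood U ⊆ ℝ of 0 with f(0) = 0 and f'(0) = −1, which is not an involution, and let m ≥ 1 and V ≠ 0 be such that f(f(x)) = x + V x^{2m+1} + O(x^{2m+2}). If V < 0 then the origin is locally asymptotically stable (LAS) for f, and if V > 0 then the origin is a repeller for f. -/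
open Filter Topology

/-- Taylor expansion of a real-analytic map with trivial linear part and vanishing coefficients
strictly between degrees `1` and `k`. -/
lemma AnalyticAt.sub_monomial_isLittleO {g : ℝ → ℝ} (hg : AnalyticAt ℝ g 0) (hg0 : g 0 = 0)
    (hg1 : deriv g 0 = 1) {k : ℕ} (hk : 2 ≤ k)
    (hvanish : ∀ j, 2 ≤ j → j < k → iteratedDeriv j g 0 = 0) :
    (fun x => g x - (x + iteratedDeriv k g 0 / k.factorial * x ^ k)) =o[𝓝 0] fun x => x ^ k := by
  have hO := hg.hasFPowerSeriesAt.isBigO_sub_partialSum_pow (k + 1)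
  have ho : (fun x : ℝ => ‖x‖ ^ (k + 1)) =o[𝓝 0] fun x => x ^ k := by
    simpa using (Asymptotics.isLittleO_pow_pow (𝕜 := ℝ) k.lt_succ_self).norm_left
  refine (hO.trans_isLittleO ho).congr_left fun x => ?_
  have hsum : ∑ j ∈ Finset.range k, x ^ j * (iteratedDeriv j g 0 / j.factorial) = x := by
    rw [Finset.sum_eq_single_of_mem 1 (Finset.mem_range.2 hk)]
    · simp [iteratedDeriv_one, hg1]
    · intro j hj hj1
      obtain rfl | hj0 := Nat.eq_zero_or_pos j
      · simp [hg0]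
      · simp [hvanish j (by omega) (Finset.mem_range.1 hj)]
  simp [FormalMultilinearSeries.partialSum, Finset.sum_range_succ, hsum, mul_comm (x ^ k)]

/-- A sequence decreasing at each step by at least `c * a n ^ k` tends to `0`. -/
lemma tendsto_zero_of_succ_le_sub_mul_pow {a : ℕ → ℝ} (ha : ∀ n, 0 ≤ a n) {c : ℝ} (hc : 0 < c)
    {k : ℕ} (h : ∀ n, a (n + 1) ≤ a n - c * a n ^ k) : Tendsto a atTop (𝓝 0) := by
  have hanti : Antitone a := antitone_nat_of_succ_le fun n =>
    (h n).trans (sub_le_self _ (mul_nonneg hc.le (pow_nonneg (ha n) k)))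
  have hlim := tendsto_atTop_ciInf hanti ⟨0, by rintro _ ⟨n, rfl⟩; exact ha n⟩
  set l := ⨅ n, a n
  have hl0 : 0 ≤ l := ge_of_tendsto' hlim ha
  have hle : l ≤ l - c * l ^ k :=
    le_of_tendsto_of_tendsto' (hlim.comp (tendsto_add_atTop_nat 1))
      (hlim.sub ((hlim.pow k).const_mul c)) h
  have hl : l = 0 := by
    by_contra hne
    have := mul_pos hc (pow_pos (lt_of_le_of_ne hl0 (Ne.symm hne)) k)
    linarith
  rwa [hl] at hlim

/-- A sequence starting at a positive value and increasing at each step by at least `c * a n ^ k`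
is unbounded. -/
lemma exists_gt_of_add_mul_pow_le_succ {a : ℕ → ℝ} (ha : 0 < a 0) {c : ℝ} (hc : 0 < c)
    {k : ℕ} {B : ℝ} (h : ∀ n, a n ≤ B → a n + c * a n ^ k ≤ a (n + 1)) : ∃ n, B < a n := by
  by_contra! hB
  have hlin : ∀ n : ℕ, a 0 + n * (c * a 0 ^ k) ≤ a n := by
    intro n
    induction n with
    | zero => simp
    | succ n ih =>
      have hd : 0 < c * a 0 ^ k := by positivity
      have h0 : a 0 ≤ a n := le_trans (by nlinarith [n.cast_nonneg (α := ℝ)]) ih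
      have hp : c * a 0 ^ k ≤ c * a n ^ k := by gcongr
      push_cast
      linarith [h n (hB n)]
  obtain ⟨n, hn⟩ := exists_nat_gt (B / (c * a 0 ^ k))
  rw [div_lt_iff₀ (by positivity)] at hn
  linarith [hlin n, hB n]

/-- If `f ∘ f` contracts to order `k` near the fixed point `0`, then `0` is a locally
asymptotically stable fixed point of `f`. -/
lemma isLAS_zero_of_abs_comp_self_le {f : ℝ → ℝ} (hf0 : f 0 = 0) (hf : ContinuousAt f 0)
    {c : ℝ} (hc : 0 < c) {k : ℕ} (h : ∀ᶠ x in 𝓝 0, |f (f x)| ≤ |x| - c * |x| ^ k) :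
    IsLAS f 0 := by
  obtain ⟨r, hr, hstep⟩ := Metric.eventually_nhds_iff.1 h
  simp only [Real.dist_eq, sub_zero] at hstep
  have hiter : ∀ x n, f^[2 * (n + 1)] x = f (f (f^[2 * n] x)) := fun x n => by
    rw [mul_add, mul_one, Function.iterate_succ_apply', Function.iterate_succ_apply']
  have hle : ∀ x, |x| < r → ∀ n, |f^[2 * n] x| ≤ |x| := by
    intro x hx n
    induction n with
    | zero => simp
    | succ n ih =>
      rw [hiter]
      have := hstep (ih.trans_lt hx)
      have : 0 ≤ c * |f^[2 * n] x| ^ k := by positivity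
      linarith
  constructor
  · intro ε hε
    obtain ⟨d, hd, hfd⟩ := Metric.continuousAt_iff.1 hf ε hε
    simp only [Real.dist_eq, sub_zero, hf0] at hfd
    refine ⟨min r (min d ε), by positivity, fun x hx n _ => ?_⟩
    rw [sub_zero, lt_min_iff, lt_min_iff] at hx
    rw [sub_zero]
    obtain ⟨j, rfl | rfl⟩ := n.even_or_odd'
    · exact (hle x hx.1 j).trans_lt hx.2.2
    · rw [Function.iterate_succ_apply']
      exact hfd ((hle x hx.1 j).trans_lt hx.2.1)
  · refine ⟨r, hr, fun x hx => ?_⟩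
    rw [sub_zero] at hx
    have heven : Tendsto (fun n => f^[2 * n] x) atTop (𝓝 0) := by
      rw [tendsto_zero_iff_abs_tendsto_zero]
      refine tendsto_zero_of_succ_le_sub_mul_pow (fun n => abs_nonneg _) hc (k := k) fun n => ?_
      simp only [Function.comp_apply, hiter]
      exact hstep ((hle x hx n).trans_lt hx)
    have hodd : Tendsto (fun n => f^[2 * n + 1] x) atTop (𝓝 0) := by
      simp only [Function.iterate_succ_apply']
      have := hf.tendsto.comp heven
      rwa [hf0] at this
    rw [Metric.tendsto_atTop] at heven hodd ⊢
    intro ε hε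
    obtain ⟨N, hN⟩ := heven ε hε
    obtain ⟨M, hM⟩ := hodd ε hε
    refine ⟨2 * (N + M) + 1, fun n hn => ?_⟩
    obtain ⟨j, rfl | rfl⟩ := n.even_or_odd'
    · exact hN j (by omega)
    · exact hM j (by omega)

/-- If `f ∘ f` expands to order `k` near `0`, then `0` is a repeller for `f`. -/
lemma isRepeller_zero_of_le_abs_comp_self {f : ℝ → ℝ}
    {c : ℝ} (hc : 0 < c) {k : ℕ} (h : ∀ᶠ x in 𝓝 0, |x| + c * |x| ^ k ≤ |f (f x)|) :
    IsRepeller f 0 := by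
  obtain ⟨r, hr, hstep⟩ := Metric.eventually_nhds_iff.1 h
  simp only [Real.dist_eq, sub_zero] at hstep
  refine ⟨r, hr, fun ε _ hεr x hx0 _ => ?_⟩
  obtain ⟨n, hn⟩ := exists_gt_of_add_mul_pow_le_succ (a := fun n => |f^[2 * n] x|) (c := c)
    (k := k) (B := ε) (by simpa using hx0) hc fun n hn => by
      simp only [mul_add, mul_one, Function.iterate_succ_apply']
      exact hstep (lt_of_le_of_lt hn hεr)
  exact ⟨2 * n, by simpa using hn⟩

/-- for an analytic map on a neighborhood of `0` with `f(0)=0`,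
`f'(0)=-1`, not an involution, with `f(f(x)) = x + V x^{2m+1} + O(x^{2m+2})`, `V ≠ 0`:
if `V < 0` the origin is LAS for `f`, and if `V > 0` the origin is a repeller for `f`. -/
theorem stmt11 (U : Set ℝ) (hU : U ∈ 𝓝 (0 : ℝ)) (f : ℝ → ℝ)
    (hf : AnalyticOnNhd ℝ f U) (hf0 : f 0 = 0) (hf1 : deriv f 0 = -1)
    (hnoninv : ¬ ∀ᶠ x in 𝓝 (0 : ℝ), f (f x) = x)
    (m : ℕ) (hm : 1 ≤ m) (V : ℝ) (hV : V ≠ 0)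
    (hvanish : ∀ j, 2 ≤ j → j ≤ 2 * m → iteratedDeriv j (f ∘ f) 0 = 0)
    (hcoef : iteratedDeriv (2 * m + 1) (f ∘ f) 0 / (Nat.factorial (2 * m + 1)) = V) :
    (V < 0 → IsLAS f 0) ∧ (0 < V → IsRepeller f 0) := by
  have hfa : AnalyticAt ℝ f 0 := hf 0 (mem_of_mem_nhds hU)
  have hfa' : AnalyticAt ℝ f (f 0) := by rwa [hf0]
  have hderiv : deriv (f ∘ f) 0 = 1 := by
    rw [deriv_comp _ hfa'.differentiableAt hfa.differentiableAt, hf0, hf1]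
    norm_num
  have htaylor := (hfa'.comp hfa).sub_monomial_isLittleO (by simp [hf0]) hderiv
    (k := 2 * m + 1) (by omega) fun j h2 hj => hvanish j h2 (by omega)
  rw [hcoef] at htaylor
  have hbound := htaylor.def (half_pos (abs_pos.2 hV))
  simp only [Function.comp_apply, Real.norm_eq_abs, abs_pow] at hbound
  have hmain : ∀ x : ℝ, |x + V * x ^ (2 * m + 1)| = |x| * |1 + V * |x| ^ (2 * m)| := fun x => by
    rw [← abs_mul, (even_two_mul m).pow_abs]
    congr 1
    ring
  constructor
  · intro hneg
    have hsmall : ∀ᶠ x : ℝ in 𝓝 0, -V * |x| ^ (2 * m) < 1 := by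
      have : ContinuousAt (fun x : ℝ => -V * |x| ^ (2 * m)) 0 := by fun_prop
      exact this.eventually_lt_const (by simp [show m ≠ 0 by omega])
    refine isLAS_zero_of_abs_comp_self_le hf0 hfa.continuousAt (half_pos (abs_pos.2 hV))
      (k := 2 * m + 1) ?_
    filter_upwards [hbound, hsmall] with x hx hs
    have h1 := abs_sub_abs_le_abs_sub (f (f x)) (x + V * x ^ (2 * m + 1))
    rw [hmain, abs_of_pos (a := 1 + V * |x| ^ (2 * m)) (by linarith)] at h1
    rw [abs_of_neg hneg] at hx ⊢
    rw [pow_succ |x|] at hx ⊢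
    linarith
  · intro hpos
    refine isRepeller_zero_of_le_abs_comp_self (half_pos hpos) (k := 2 * m + 1) ?_
    filter_upwards [hbound] with x hx
    have h1 := abs_sub_abs_le_abs_sub (x + V * x ^ (2 * m + 1)) (f (f x))
    rw [hmain, abs_of_pos (a := 1 + V * |x| ^ (2 * m)) (by positivity), abs_sub_comm] at h1
    rw [abs_of_pos hpos] at hx
    rw [pow_succ |x|] at hx ⊢
    linarith
end

section
/- Let f be a map of class C^{12} on a neighborhood of 0 in ℝ with f(0) = 0 and f'(0) = −1, and set a_j = f^{(j)}(0)/j!. Then the coefficient of x³ in the Taylor expansion at 0 of f ∘ f equals W₃ = 2(−a₂² − a₃). Moreover, if W₃ = 0 (equivalently a₃ = −a₂²), then the coefficient of x⁴ of f ∘ f vanishes and the coefficient of x⁵ equals W₅ = 2(2a₂⁴ − 3a₂a₄ − a₅). -/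
open Filter Topology

theorem ContDiffAt.eventually_hasDerivAt_iteratedDeriv {f : ℝ → ℝ} {x : ℝ} {n k : ℕ}
    (hf : ContDiffAt ℝ n f x) (hk : k < n) :
    ∀ᶠ y in 𝓝 x, HasDerivAt (iteratedDeriv k f) (iteratedDeriv (k + 1) f y) y := by
  filter_upwards [hf.eventually (by simp)] with y hy
  have hd : DifferentiableAt ℝ (iteratedDeriv k f) y := by
    rw [← iteratedDerivWithin_univ, ← differentiableWithinAt_univ]
    exact hy.contDiffWithinAt.differentiableWithinAt_iteratedDerivWithin (by exact_mod_cast hk)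
      (by simp [uniqueDiffOn_univ])
  rw [iteratedDeriv_succ]
  exact hd.hasDerivAt

theorem Filter.EventuallyEq.iteratedDeriv_succ_of_hasDerivAt {h p p' : ℝ → ℝ} {x : ℝ} {n : ℕ}
    (hp : iteratedDeriv n h =ᶠ[𝓝 x] p) (hp' : ∀ᶠ y in 𝓝 x, HasDerivAt p (p' y) y) :
    iteratedDeriv (n + 1) h =ᶠ[𝓝 x] p' := by
  rw [iteratedDeriv_succ]
  filter_upwards [hp.deriv, hp'] with y hy hy'
  rw [hy, hy'.deriv]

/-- Faà di Bruno's formula in one variable, for the derivatives of order three, four and five. -/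
theorem iteratedDeriv_comp_three_four_five {f g : ℝ → ℝ} {x : ℝ}
    (hg : ContDiffAt ℝ 5 g (f x)) (hf : ContDiffAt ℝ 5 f x) :
    iteratedDeriv 3 (g ∘ f) =ᶠ[𝓝 x] (fun y =>
        iteratedDeriv 3 g (f y) * iteratedDeriv 1 f y ^ 3
        + 3 * iteratedDeriv 2 g (f y) * iteratedDeriv 1 f y * iteratedDeriv 2 f y
        + iteratedDeriv 1 g (f y) * iteratedDeriv 3 f y) ∧
    iteratedDeriv 4 (g ∘ f) =ᶠ[𝓝 x] (fun y =>
        iteratedDeriv 4 g (f y) * iteratedDeriv 1 f y ^ 4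
        + 6 * iteratedDeriv 3 g (f y) * iteratedDeriv 1 f y ^ 2 * iteratedDeriv 2 f y
        + iteratedDeriv 2 g (f y) *
          (4 * iteratedDeriv 1 f y * iteratedDeriv 3 f y + 3 * iteratedDeriv 2 f y ^ 2)
        + iteratedDeriv 1 g (f y) * iteratedDeriv 4 f y) ∧
    iteratedDeriv 5 (g ∘ f) =ᶠ[𝓝 x] (fun y =>
        iteratedDeriv 5 g (f y) * iteratedDeriv 1 f y ^ 5
        + 10 * iteratedDeriv 4 g (f y) * iteratedDeriv 1 f y ^ 3 * iteratedDeriv 2 f y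
        + iteratedDeriv 3 g (f y) *
          (10 * iteratedDeriv 1 f y ^ 2 * iteratedDeriv 3 f y
            + 15 * iteratedDeriv 1 f y * iteratedDeriv 2 f y ^ 2)
        + iteratedDeriv 2 g (f y) *
          (5 * iteratedDeriv 1 f y * iteratedDeriv 4 f y
            + 10 * iteratedDeriv 2 f y * iteratedDeriv 3 f y)
        + iteratedDeriv 1 g (f y) * iteratedDeriv 5 f y) := by
  have hF (k : ℕ) (hk : k < 5) := hf.eventually_hasDerivAt_iteratedDeriv (n := 5) hk
  have hG (k : ℕ) (hk : k < 5) : ∀ᶠ y in 𝓝 x, HasDerivAt (fun z => iteratedDeriv k g (f z))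
      (iteratedDeriv (k + 1) g (f y) * iteratedDeriv 1 f y) y := by
    filter_upwards [hF 0 (by simp), hf.continuousAt.eventually
      (hg.eventually_hasDerivAt_iteratedDeriv (n := 5) hk)] with y hy hy'
    rw [iteratedDeriv_zero] at hy
    exact hy'.comp y hy
  have h0 : iteratedDeriv 0 (g ∘ f) =ᶠ[𝓝 x] fun z => iteratedDeriv 0 g (f z) := by
    simp [Function.comp_def]
  have h1 := h0.iteratedDeriv_succ_of_hasDerivAt (hG 0 (by simp))
  have h2 : iteratedDeriv 2 (g ∘ f) =ᶠ[𝓝 x] fun y =>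
      iteratedDeriv 2 g (f y) * iteratedDeriv 1 f y ^ 2
        + iteratedDeriv 1 g (f y) * iteratedDeriv 2 f y := by
    refine h1.iteratedDeriv_succ_of_hasDerivAt ?_
    filter_upwards [hG 1 (by simp), hF 1 (by simp)] with y g1 f1
    exact (g1.mul f1).congr_deriv (by ring)
  have h3 : iteratedDeriv 3 (g ∘ f) =ᶠ[𝓝 x] fun y =>
      iteratedDeriv 3 g (f y) * iteratedDeriv 1 f y ^ 3
        + 3 * iteratedDeriv 2 g (f y) * iteratedDeriv 1 f y * iteratedDeriv 2 f y
        + iteratedDeriv 1 g (f y) * iteratedDeriv 3 f y := by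
    refine h2.iteratedDeriv_succ_of_hasDerivAt ?_
    filter_upwards [hG 1 (by simp), hG 2 (by simp), hF 1 (by simp), hF 2 (by simp)]
      with y g1 g2 f1 f2
    exact ((g2.mul (f1.pow 2)).add (g1.mul f2)).congr_deriv (by simp; ring)
  have h4 : iteratedDeriv 4 (g ∘ f) =ᶠ[𝓝 x] fun y =>
      iteratedDeriv 4 g (f y) * iteratedDeriv 1 f y ^ 4
        + 6 * iteratedDeriv 3 g (f y) * iteratedDeriv 1 f y ^ 2 * iteratedDeriv 2 f y
        + iteratedDeriv 2 g (f y) *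
          (4 * iteratedDeriv 1 f y * iteratedDeriv 3 f y + 3 * iteratedDeriv 2 f y ^ 2)
        + iteratedDeriv 1 g (f y) * iteratedDeriv 4 f y := by
    refine h3.iteratedDeriv_succ_of_hasDerivAt ?_
    filter_upwards [hG 1 (by simp), hG 2 (by simp), hG 3 (by simp), hF 1 (by simp),
      hF 2 (by simp), hF 3 (by simp)] with y g1 g2 g3 f1 f2 f3
    exact (((g3.mul (f1.pow 3)).add (((g2.const_mul 3).mul f1).mul f2)).add
      (g1.mul f3)).congr_deriv (by simp; ring)
  refine ⟨h3, h4, h4.iteratedDeriv_succ_of_hasDerivAt ?_⟩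
  filter_upwards [hG 1 (by simp), hG 2 (by simp), hG 3 (by simp), hG 4 (by simp),
    hF 1 (by simp), hF 2 (by simp), hF 3 (by simp), hF 4 (by simp)] with y g1 g2 g3 g4 f1 f2 f3 f4
  exact ((((g4.mul (f1.pow 4)).add (((g3.const_mul 6).mul (f1.pow 2)).mul f2)).add
    (g2.mul (((f1.const_mul 4).mul f3).add ((f2.pow 2).const_mul 3)))).add
    (g1.mul f4)).congr_deriv (by simp; ring)

/-- for a `C^{12}` map on a neighborhood of `0` with `f(0)=0`,
`f'(0)=-1` and Taylor coefficients `aⱼ = f⁽ʲ⁾(0)/j!`, the coefficient of `x³` in the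
Taylor expansion of `f ∘ f` equals `W₃ = 2(-a₂² - a₃)`; moreover if `W₃ = 0`
(equivalently `a₃ = -a₂²`), then the coefficient of `x⁴` of `f ∘ f` vanishes and the
coefficient of `x⁵` equals `W₅ = 2(2a₂⁴ - 3a₂a₄ - a₅)`. -/
theorem stmt12 (U : Set ℝ) (hU : U ∈ 𝓝 (0 : ℝ)) (f : ℝ → ℝ)
    (hreg : ContDiffOn ℝ 12 f U) (hf0 : f 0 = 0) (hf1 : deriv f 0 = -1)
    (a : ℕ → ℝ) (ha : ∀ j, a j = iteratedDeriv j f 0 / (Nat.factorial j)) :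
    iteratedDeriv 3 (f ∘ f) 0 / (Nat.factorial 3) = 2 * (-(a 2) ^ 2 - a 3) ∧
    (a 3 = -(a 2) ^ 2 →
      iteratedDeriv 4 (f ∘ f) 0 = 0 ∧
      iteratedDeriv 5 (f ∘ f) 0 / (Nat.factorial 5)
        = 2 * (2 * (a 2) ^ 4 - 3 * (a 2) * (a 4) - a 5)) := by
  have hf : ContDiffAt ℝ 5 f 0 := (hreg.contDiffAt hU).of_le (by norm_num)
  obtain ⟨h3, h4, h5⟩ := iteratedDeriv_comp_three_four_five (g := f) (hf0.symm ▸ hf) hf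
  have d1 : iteratedDeriv 1 f 0 = -1 := by rw [iteratedDeriv_one, hf1]
  have hd (j : ℕ) : iteratedDeriv j f 0 = j.factorial * a j := by
    rw [ha]
    field_simp
  replace h3 := h3.eq_of_nhds
  replace h4 := h4.eq_of_nhds
  replace h5 := h5.eq_of_nhds
  rw [hf0, d1, hd 2, hd 3] at h3
  rw [hf0, d1, hd 2, hd 3, hd 4] at h4
  rw [hf0, d1, hd 2, hd 3, hd 4, hd 5] at h5
  simp only [Nat.factorial] at h3 h4 h5 ⊢
  push_cast at h3 h4 h5 ⊢
  refine ⟨by rw [h3]; ring, fun h => ⟨by rw [h4, h]; ring, by rw [h5, h]; ring⟩⟩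
end

section
/- Let m ≥ 1 be an integer and c ∈ ℝ. For the map f(x) = x + x^{m+1} + c x^{2m+1}, the origin is a semi-asymptotically stable from the left fixed point if m is odd, and a repeller fixed point if m is even. For the map g(x) = x − x^{m+1} + c x^{2m+1}, the origin is a semi-asymptotically stable from the right fixed point if m is odd, and a locally asymptotically stable (LAS) fixed point if m is even. -/
open Filter Topology

/-- Iterates of a continuous map with `0 < h x < x` on `(0, r]` decrease to `0`. -/
theorem iterate_tendsto_zero {h : ℝ → ℝ} (hc : Continuous h) {r : ℝ}
    (H : ∀ x, 0 < x → x ≤ r → 0 < h x ∧ h x < x) {x : ℝ} (hx : 0 < x) (hxr : x ≤ r) :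
    (∀ n, 0 < h^[n] x ∧ h^[n] x ≤ x) ∧ Tendsto (fun n => h^[n] x) atTop (𝓝 0) := by
  have hb : ∀ n, 0 < h^[n] x ∧ h^[n] x ≤ x := by
    intro n
    induction n with
    | zero => simpa using hx
    | succ k ih =>
      rw [Function.iterate_succ_apply']
      have := H _ ih.1 (ih.2.trans hxr)
      exact ⟨this.1, this.2.le.trans ih.2⟩
  refine ⟨hb, ?_⟩
  have hanti : Antitone (fun n => h^[n] x) := antitone_nat_of_succ_le fun n => by
    rw [Function.iterate_succ_apply']
    exact (H _ (hb n).1 ((hb n).2.trans hxr)).2.le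
  have hl := tendsto_atTop_ciInf hanti ⟨0, by rintro _ ⟨n, rfl⟩; exact (hb n).1.le⟩
  set l := ⨅ n, h^[n] x
  have hfix : h l = l := isFixedPt_of_tendsto_iterate hl hc.continuousAt
  have h0 : 0 ≤ l := ge_of_tendsto' hl fun n => (hb n).1.le
  have hlx : l ≤ x := le_of_tendsto' hl fun n => (hb n).2
  rcases h0.eq_or_lt with h0 | h0
  · rwa [← h0] at hl
  · exact absurd hfix (H l h0 (hlx.trans hxr)).2.ne

/-- Iterates of a continuous map with `x < h x` on `(0, r]` leave `(0, r]`. -/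
theorem exists_lt_iterate {h : ℝ → ℝ} (hc : Continuous h) {r : ℝ}
    (H : ∀ x, 0 < x → x ≤ r → x < h x) {x : ℝ} (hx : 0 < x) :
    ∃ n, r < h^[n] x := by
  by_contra! hb
  have hpos : ∀ n, 0 < h^[n] x := by
    intro n
    induction n with
    | zero => simpa using hx
    | succ k ih =>
      rw [Function.iterate_succ_apply']
      exact ih.trans (H _ ih (hb k))
  have hmono : Monotone (fun n => h^[n] x) := monotone_nat_of_le_succ fun n => by
    rw [Function.iterate_succ_apply']
    exact (H _ (hpos n) (hb n)).le
  have hl := tendsto_atTop_ciSup hmono ⟨r, by rintro _ ⟨n, rfl⟩; exact hb n⟩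
  set l := ⨆ n, h^[n] x
  have hfix : h l = l := isFixedPt_of_tendsto_iterate hl hc.continuousAt
  have hxl : x ≤ l := ge_of_tendsto' hl fun n => hmono (Nat.zero_le n)
  have hlr : l ≤ r := le_of_tendsto' hl hb
  exact absurd hfix (H l (hx.trans_le hxl) hlr).ne'

/-- The conjugate of `f` by `x ↦ -x`. -/
def negConj (f : ℝ → ℝ) (x : ℝ) : ℝ := -f (-x)

theorem negConj_iterate (f : ℝ → ℝ) (n : ℕ) (x : ℝ) : (negConj f)^[n] x = -f^[n] (-x) := by
  have h : Function.Semiconj (fun y : ℝ => -y) (negConj f) f := fun y => by simp [negConj]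
  have := h.iterate_right n x
  rw [← this, neg_neg]

/-- `0` attracts the points to its right. -/
def AttractsRight (f : ℝ → ℝ) : Prop :=
  ∃ r > 0, ∀ x, 0 < x → x ≤ r →
    (∀ n, |f^[n] x| ≤ x) ∧ Tendsto (fun n => f^[n] x) atTop (𝓝 0)

/-- The points to the right of `0` escape from every small neighborhood of `0`. -/
def RepelsRight (f : ℝ → ℝ) : Prop :=
  ∃ r > 0, ∀ ε ≤ r, ∀ x, 0 < x → ∃ n, ε < |f^[n] x|

theorem AttractsRight.left {f : ℝ → ℝ} (h : AttractsRight (negConj f)) :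
    ∃ r > 0, ∀ x, x < 0 → -r ≤ x →
      (∀ n, |f^[n] x| ≤ -x) ∧ Tendsto (fun n => f^[n] x) atTop (𝓝 0) := by
  obtain ⟨r, hr, h⟩ := h
  refine ⟨r, hr, fun x hx hxr => ?_⟩
  obtain ⟨h1, h2⟩ := h (-x) (by linarith) (by linarith)
  simp only [negConj_iterate, neg_neg, abs_neg] at h1 h2
  exact ⟨h1, by simpa using h2.neg⟩

theorem RepelsRight.left {f : ℝ → ℝ} (h : RepelsRight (negConj f)) :
    ∃ r > 0, ∀ ε ≤ r, ∀ x < 0, ∃ n, ε < |f^[n] x| := by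
  obtain ⟨r, hr, h⟩ := h
  refine ⟨r, hr, fun ε hε x hx => ?_⟩
  simpa [negConj_iterate] using h ε hε (-x) (by linarith)

theorem AttractsRight.isSemiASRight {f : ℝ → ℝ} (ha : AttractsRight f)
    (hr : RepelsRight (negConj f)) : IsSemiASRight f 0 := by
  obtain ⟨r, hr0, ha⟩ := ha
  obtain ⟨s, hs0, hr⟩ := hr.left
  simp only [IsSemiASRight, sub_zero, zero_add, zero_sub, Set.mem_Ioo]
  refine ⟨fun ε hε => ⟨min r ε, lt_min hr0 hε, fun x hx n _ => ?_⟩,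
    ⟨r, hr0, fun x hx => (ha x hx.1 hx.2.le).2⟩, ⟨s, hs0, fun x hx => hr s le_rfl x hx.2⟩⟩
  have hx' := lt_min_iff.1 hx.2
  exact ((ha x hx.1 hx'.1.le).1 n).trans_lt hx'.2

theorem AttractsRight.isSemiASLeft {f : ℝ → ℝ} (ha : AttractsRight (negConj f))
    (hr : RepelsRight f) : IsSemiASLeft f 0 := by
  obtain ⟨r, hr0, ha⟩ := ha.left
  obtain ⟨s, hs0, hr⟩ := hr
  simp only [IsSemiASLeft, sub_zero, zero_add, zero_sub, Set.mem_Ioo]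
  refine ⟨fun ε hε => ⟨min r ε, lt_min hr0 hε, fun x hx n _ => ?_⟩,
    ⟨r, hr0, fun x hx => (ha x hx.2 hx.1.le).2⟩, ⟨s, hs0, fun x hx => hr s le_rfl x hx.1⟩⟩
  have hx' := lt_min_iff.1 (neg_lt.1 hx.1)
  exact ((ha x hx.2 (by linarith)).1 n).trans_lt hx'.2

theorem AttractsRight.isLAS {f : ℝ → ℝ} (h0 : f 0 = 0) (ha : AttractsRight f)
    (hb : AttractsRight (negConj f)) : IsLAS f 0 := by
  obtain ⟨r, hr, ha⟩ := ha
  obtain ⟨s, hs, hb⟩ := hb.left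
  have key : ∀ x, |x| < min r s →
      (∀ n, |f^[n] x| ≤ |x|) ∧ Tendsto (fun n => f^[n] x) atTop (𝓝 0) := by
    intro x hx
    obtain ⟨hxr, hxs⟩ := lt_min_iff.1 hx
    rcases lt_trichotomy x 0 with h | rfl | h
    · rw [abs_of_neg h] at hxs ⊢
      exact hb x h (by linarith)
    · simp [Function.iterate_fixed h0]
    · rw [abs_of_pos h] at hxr ⊢
      exact ha x h hxr.le
  simp only [IsLAS, sub_zero]
  refine ⟨fun ε hε => ⟨min (min r s) ε, lt_min (lt_min hr hs) hε, fun x hx n _ => ?_⟩,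
    ⟨min r s, lt_min hr hs, fun x hx => (key x hx).2⟩⟩
  have hx' := lt_min_iff.1 hx
  exact ((key x hx'.1).1 n).trans_lt hx'.2

theorem RepelsRight.isRepeller {f : ℝ → ℝ} (ha : RepelsRight f)
    (hb : RepelsRight (negConj f)) : IsRepeller f 0 := by
  obtain ⟨r, hr, ha⟩ := ha
  obtain ⟨s, hs, hb⟩ := hb.left
  simp only [IsRepeller, sub_zero]
  refine ⟨min r s, lt_min hr hs, fun ε _ hε x hx _ => ?_⟩
  obtain ⟨hεr, hεs⟩ := lt_min_iff.1 hε
  rcases lt_or_gt_of_ne hx with h | h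
  · exact hb ε hεs.le x h
  · exact ha ε hεr.le x h

theorem exists_radius {m : ℕ} (hm : 1 ≤ m) (c : ℝ) :
    ∃ r > 0, ∀ x : ℝ, 0 < x → x ≤ r → 0 < x ^ m ∧ x ^ m ≤ 1 / 2 ∧ |c * x ^ m| ≤ 1 / 2 := by
  have hc := abs_nonneg c
  refine ⟨1 / (2 * (|c| + 1)), by positivity, fun x hx hxr => ?_⟩
  have hx2 : x * (2 * (|c| + 1)) ≤ 1 := (le_div_iff₀ (by positivity)).1 hxr
  have hxc : 0 ≤ |c| * x := by positivity
  have hxm : x ^ m ≤ x := pow_le_of_le_one hx.le (by nlinarith) (by omega)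
  have hpos : 0 < x ^ m := by positivity
  refine ⟨hpos, by nlinarith, ?_⟩
  rw [abs_mul, abs_of_pos hpos]
  nlinarith

theorem repelsRight_add_pow {m : ℕ} (hm : 1 ≤ m) (c : ℝ) :
    RepelsRight (fun x : ℝ => x + x ^ (m + 1) + c * x ^ (2 * m + 1)) := by
  obtain ⟨r, hr, h⟩ := exists_radius hm c
  refine ⟨r, hr, fun ε hε x hx => ?_⟩
  have H : ∀ y, 0 < y → y ≤ ε → y < y + y ^ (m + 1) + c * y ^ (2 * m + 1) := by
    intro y hy hyr
    obtain ⟨h1, -, h3⟩ := h y hy (hyr.trans hε)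
    have : 0 < y * y ^ m * (1 + c * y ^ m) :=
      mul_pos (mul_pos hy h1) (by linarith [(abs_le.1 h3).1])
    have e : y + y ^ (m + 1) + c * y ^ (2 * m + 1) = y + y * y ^ m * (1 + c * y ^ m) := by ring
    linarith
  obtain ⟨n, hn⟩ := exists_lt_iterate (by fun_prop) H hx
  exact ⟨n, hn.trans_le (le_abs_self _)⟩

theorem attractsRight_sub_pow {m : ℕ} (hm : 1 ≤ m) (c : ℝ) :
    AttractsRight (fun x : ℝ => x - x ^ (m + 1) + c * x ^ (2 * m + 1)) := by
  obtain ⟨r, hr, h⟩ := exists_radius hm c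
  have H : ∀ y, 0 < y → y ≤ r → 0 < y - y ^ (m + 1) + c * y ^ (2 * m + 1) ∧
      y - y ^ (m + 1) + c * y ^ (2 * m + 1) < y := by
    intro y hy hyr
    obtain ⟨h1, h2, h3⟩ := h y hy hyr
    obtain ⟨h3, h4⟩ := abs_le.1 h3
    have hlt : 0 < y * y ^ m * (1 - c * y ^ m) := mul_pos (mul_pos hy h1) (by linarith)
    have hpos : 0 < y * (1 - y ^ m * (1 - c * y ^ m)) := mul_pos hy (by nlinarith)
    have e : y - y ^ (m + 1) + c * y ^ (2 * m + 1) = y - y * y ^ m * (1 - c * y ^ m) := by ring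
    constructor <;> linarith
  refine ⟨r, hr, fun x hx hxr => ?_⟩
  obtain ⟨h1, h2⟩ := iterate_tendsto_zero (by fun_prop) H hx hxr
  exact ⟨fun n => by rw [abs_of_pos (h1 n).1]; exact (h1 n).2, h2⟩

theorem negConj_add_pow (m : ℕ) (c : ℝ) :
    negConj (fun x : ℝ => x + x ^ (m + 1) + c * x ^ (2 * m + 1)) =
      fun x => x + (-1) ^ m * x ^ (m + 1) + c * x ^ (2 * m + 1) := by
  funext x
  have h : (-x) ^ (2 * m + 1) = -x ^ (2 * m + 1) := Odd.neg_pow ⟨m, rfl⟩ x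
  simp only [negConj, h, neg_pow x (m + 1)]
  ring

theorem negConj_sub_pow (m : ℕ) (c : ℝ) :
    negConj (fun x : ℝ => x - x ^ (m + 1) + c * x ^ (2 * m + 1)) =
      fun x => x - (-1) ^ m * x ^ (m + 1) + c * x ^ (2 * m + 1) := by
  funext x
  have h : (-x) ^ (2 * m + 1) = -x ^ (2 * m + 1) := Odd.neg_pow ⟨m, rfl⟩ x
  simp only [negConj, h, neg_pow x (m + 1)]
  ring

/-- for `f(x) = x + x^{m+1} + c x^{2m+1}` the origin is semi-AS from the
left if `m` is odd and a repeller if `m` is even; for `g(x) = x - x^{m+1} + c x^{2m+1}`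
the origin is semi-AS from the right if `m` is odd and LAS if `m` is even. -/
theorem stmt13 (m : ℕ) (hm : 1 ≤ m) (c : ℝ) :
    (Odd m → IsSemiASLeft (fun x : ℝ => x + x ^ (m + 1) + c * x ^ (2 * m + 1)) 0) ∧
    (Even m → IsRepeller (fun x : ℝ => x + x ^ (m + 1) + c * x ^ (2 * m + 1)) 0) ∧
    (Odd m → IsSemiASRight (fun x : ℝ => x - x ^ (m + 1) + c * x ^ (2 * m + 1)) 0) ∧
    (Even m → IsLAS (fun x : ℝ => x - x ^ (m + 1) + c * x ^ (2 * m + 1)) 0) := by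
  have hrep := repelsRight_add_pow hm c
  have hatt := attractsRight_sub_pow hm c
  refine ⟨fun h => AttractsRight.isSemiASLeft ?_ hrep, fun h => hrep.isRepeller ?_,
    fun h => hatt.isSemiASRight ?_, fun h => hatt.isLAS (by simp) ?_⟩
  · rw [negConj_add_pow, h.neg_one_pow]
    simpa [← sub_eq_add_neg] using hatt
  · rw [negConj_add_pow, h.neg_one_pow]
    simpa using hrep
  · rw [negConj_sub_pow, h.neg_one_pow]
    simpa using hrep
  · rw [negConj_sub_pow, h.neg_one_pow]
    simpa using hatt
end

section
/- Let r ≥ 1 be an integer and c ∈ ℝ. For the map f(x) = −x + x^{2r+1} + c x^{4r+1}, the origin is a locally asymptotically stable (LAS) fixed point. For the map g(x) = −x − x^{2r+1} + c x^{4r+1}, the origin is a repeller fixed point. -/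
open Filter Topology

/-- If `|f x|` is a continuous function `φ` of `|x|`, then so is every iterate, and a limit of the
sizes of the iterates is a fixed point of `φ`. -/
theorem isFixedPt_of_tendsto_abs_iterate {f φ : ℝ → ℝ} (hφ : Continuous φ)
    (hf : ∀ x, |f x| = φ |x|) {x L : ℝ} (hL : Tendsto (fun n => |f^[n] x|) atTop (𝓝 L)) :
    φ L = L := by
  have hstep : Tendsto (fun n => |f^[n + 1] x|) atTop (𝓝 (φ L)) := by
    simpa only [Function.iterate_succ_apply', hf, Function.comp_def] using
      (hφ.tendsto L).comp hL
  exact tendsto_nhds_unique hstep ((tendsto_add_atTop_iff_nat 1).2 hL)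

/-- The origin is locally asymptotically stable if `f` strictly decreases small absolute values. -/
theorem isLAS_zero_of_abs_lt {f φ : ℝ → ℝ} (hφ : Continuous φ) (hf : ∀ x, |f x| = φ |x|)
    (h0 : φ 0 = 0) {η : ℝ} (hη : 0 < η) (hlt : ∀ t, 0 < t → t < η → φ t < t) :
    IsLAS f 0 := by
  have hle : ∀ x, |x| < η → |f x| ≤ |x| := by
    intro x hx
    rw [hf]
    rcases (abs_nonneg x).eq_or_lt with h | h
    · rw [← h, h0]
    · exact (hlt _ h hx).le
  have hiter : ∀ x, |x| < η → ∀ n, |f^[n] x| ≤ |x| := by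
    intro x hx n
    induction n with
    | zero => simp
    | succ n ih =>
      rw [Function.iterate_succ_apply']
      exact (hle _ (ih.trans_lt hx)).trans ih
  simp only [IsLAS, sub_zero]
  refine ⟨fun ε hε => ⟨min ε η, lt_min hε hη, fun x hx n _ => ?_⟩, η, hη, fun x hx => ?_⟩
  · exact (hiter x (hx.trans_le (min_le_right _ _)) n).trans_lt (hx.trans_le (min_le_left _ _))
  · have hanti : Antitone fun n => |f^[n] x| := antitone_nat_of_succ_le fun n => by
      rw [Function.iterate_succ_apply']
      exact hle _ ((hiter x hx n).trans_lt hx)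
    have hlim := tendsto_atTop_ciInf hanti ⟨0, by rintro _ ⟨n, rfl⟩; exact abs_nonneg _⟩
    have hfix := isFixedPt_of_tendsto_abs_iterate hφ hf hlim
    have hnonneg := ge_of_tendsto' hlim fun n => abs_nonneg (f^[n] x)
    have hbound := le_of_tendsto' hlim (hiter x hx)
    rcases hnonneg.eq_or_lt with h | h
    · rw [← h] at hlim
      exact (tendsto_zero_iff_abs_tendsto_zero _).2 hlim
    · exact absurd hfix (hlt _ h (hbound.trans_lt hx)).ne

/-- The origin is a repeller if `f` strictly increases small nonzero absolute values. -/
theorem isRepeller_zero_of_lt_abs {f φ : ℝ → ℝ} (hφ : Continuous φ) (hf : ∀ x, |f x| = φ |x|)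
    {η : ℝ} (hη : 0 < η) (hlt : ∀ t, 0 < t → t < η → t < φ t) :
    IsRepeller f 0 := by
  refine ⟨η, hη, fun ε _ hεη x hx _ => ?_⟩
  simp only [sub_zero]
  by_contra! hbdd
  have hpos : 0 < |x| := abs_pos.2 hx
  have hiter : ∀ n, |x| ≤ |f^[n] x| := by
    intro n
    induction n with
    | zero => simp
    | succ n ih =>
      rw [Function.iterate_succ_apply', hf]
      exact ih.trans (hlt _ (hpos.trans_le ih) ((hbdd n).trans_lt hεη)).le
  have hmono : Monotone fun n => |f^[n] x| := monotone_nat_of_le_succ fun n => by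
    rw [Function.iterate_succ_apply', hf]
    exact (hlt _ (hpos.trans_le (hiter n)) ((hbdd n).trans_lt hεη)).le
  have hlim := tendsto_atTop_ciSup hmono ⟨ε, by rintro _ ⟨n, rfl⟩; exact hbdd n⟩
  have hfix := isFixedPt_of_tendsto_abs_iterate hφ hf hlim
  have hL := hlt _ (hpos.trans_le (ge_of_tendsto' hlim hiter))
    ((le_of_tendsto' hlim hbdd).trans_lt hεη)
  exact hL.ne' hfix

/-- Even powers of a small `t` make `c * t ^ (2 * r)` smaller than one. -/
theorem pow_two_mul_small {r : ℕ} (hr : 1 ≤ r) (c : ℝ) {t : ℝ} (ht0 : 0 < t)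
    (ht : t < 1 / (1 + |c|)) :
    0 < t ^ (2 * r) ∧ t ^ (2 * r) < 1 ∧ |c * t ^ (2 * r)| < 1 := by
  have hc := abs_nonneg c
  have htc : t * (1 + |c|) < 1 := (lt_div_iff₀ (by positivity)).1 ht
  have ht1 : t < 1 := by nlinarith
  have hpos : 0 < t ^ (2 * r) := by positivity
  have hle : t ^ (2 * r) ≤ t := pow_le_of_le_one ht0.le ht1.le (by omega)
  refine ⟨hpos, hle.trans_lt ht1, ?_⟩
  rw [abs_mul, abs_of_pos hpos]
  nlinarith [mul_le_mul_of_nonneg_left hle hc]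

/-- for `f(x) = -x + x^{2r+1} + c x^{4r+1}` the origin is a LAS fixed
point, and for `g(x) = -x - x^{2r+1} + c x^{4r+1}` the origin is a repeller. -/
theorem stmt14 (r : ℕ) (hr : 1 ≤ r) (c : ℝ) :
    IsLAS (fun x : ℝ => -x + x ^ (2 * r + 1) + c * x ^ (4 * r + 1)) 0 ∧
    IsRepeller (fun x : ℝ => -x - x ^ (2 * r + 1) + c * x ^ (4 * r + 1)) 0 := by
  have hη : 0 < 1 / (1 + |c|) := by positivity
  have habs : ∀ x : ℝ, |x| ^ (2 * r) = x ^ (2 * r) := (even_two_mul r).pow_abs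
  constructor
  · refine isLAS_zero_of_abs_lt
      (φ := fun t => t * |1 - t ^ (2 * r) - c * (t ^ (2 * r)) ^ 2|)
      (by fun_prop) (fun x => ?_) (by simp) hη fun t ht0 ht => ?_
    · rw [habs, ← abs_mul, ← abs_neg]
      congr 1
      ring
    · obtain ⟨hu0, hu1, hcu⟩ := pow_two_mul_small hr c ht0 ht
      obtain ⟨hcu1, hcu2⟩ := abs_lt.1 hcu
      refine mul_lt_of_lt_one_right ht0 (abs_lt.2 ⟨?_, ?_⟩) <;> nlinarith
  · refine isRepeller_zero_of_lt_abs
      (φ := fun t => t * |1 + t ^ (2 * r) - c * (t ^ (2 * r)) ^ 2|)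
      (by fun_prop) (fun x => ?_) hη fun t ht0 ht => ?_
    · rw [habs, ← abs_mul, ← abs_neg]
      congr 1
      ring
    · obtain ⟨hu0, hu1, hcu⟩ := pow_two_mul_small hr c ht0 ht
      obtain ⟨hcu1, hcu2⟩ := abs_lt.1 hcu
      refine lt_mul_of_one_lt_right ht0 (lt_of_lt_of_le ?_ (le_abs_self _))
      nlinarith
end

section
/- Let f be a real-analytic map on a neighborhood of 0 in ℝ which is not an involution, with Taylor expansion f(x) = −x + Σ_{j≥2} a_j x^j at 0, and let m ≥ 1. Assume that a_{2j} = 0 for all j = 1, 2, …, m and that the coefficient of x^{2j+1} in the Taylor expansion at 0 of f ∘ f vanishes for all j = 1, 2, …, m. Then a_{2j+1} = 0 for all j = 1, 2, …, m. -/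
open Filter Topology

/-- If `f(x) = c x + xⁿ g(x)` near `0` with `n ≥ 2`, then `f⁽ⁿ⁾(0) = n! g(0)`. -/
lemma iteratedDeriv_eq_of_eventuallyEq_linear_add_pow_mul {f g : ℝ → ℝ} {c : ℝ} {n : ℕ}
    (hn : 2 ≤ n) (hg : AnalyticAt ℝ g 0)
    (hfg : ∀ᶠ x in 𝓝 (0 : ℝ), f x = c * x + x ^ n * g x) :
    iteratedDeriv n f 0 = n.factorial * g 0 := by
  have hlin : AnalyticAt ℝ (fun x : ℝ ↦ c * x) 0 := by fun_prop
  have hpow : AnalyticAt ℝ (fun x : ℝ ↦ x ^ n) 0 := by fun_prop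
  have hrem : AnalyticAt ℝ (fun x ↦ x ^ n * g x) 0 := hpow.fun_mul hg
  have hfg' : f =ᶠ[𝓝 0] fun x ↦ c * x + x ^ n * g x := hfg
  rw [(hfg'.iteratedDeriv n).self_of_nhds,
    iteratedDeriv_fun_add hlin.contDiffAt hrem.contDiffAt,
    iteratedDeriv_fun_mul hpow.contDiffAt hg.contDiffAt, Finset.sum_range_succ,
    Finset.sum_eq_zero]
  · have h1 : n ≠ 1 := by lia
    rw [iteratedDeriv_const_mul_field, iteratedDeriv_fun_id_zero, iteratedDeriv_fun_pow_zero]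
    simp [h1]
  · intro i hi
    rw [iteratedDeriv_fun_pow_zero, if_neg (Finset.mem_range.mp hi).ne]
    simp

/-- If `f(x) = -x + xⁿ g(x)` near `0` with `n ≥ 3` odd, then the `n`-th Taylor coefficient of
`f ∘ f` at `0` is `-2 g(0)`. -/
lemma iteratedDeriv_comp_self_of_eventuallyEq_neg_add_pow_mul {f g : ℝ → ℝ} {n : ℕ}
    (hn : 2 ≤ n) (hodd : Odd n) (hf : AnalyticAt ℝ f 0) (hf0 : f 0 = 0) (hg : AnalyticAt ℝ g 0)
    (hfg : ∀ᶠ x in 𝓝 (0 : ℝ), f x = -x + x ^ n * g x) :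
    iteratedDeriv n (f ∘ f) 0 = n.factorial * (-2 * g 0) := by
  obtain ⟨k, rfl⟩ : ∃ k, n = k + 1 := ⟨n - 1, by lia⟩
  have hgf : AnalyticAt ℝ (fun x ↦ g (f x)) 0 :=
    AnalyticAt.comp (g := g) (f := f) (by rwa [hf0]) hf
  have hh : AnalyticAt ℝ (fun x ↦ -g x + (-1 + x ^ k * g x) ^ (k + 1) * g (f x)) 0 :=
    hg.fun_neg.fun_add (((analyticAt_const.fun_add ((analyticAt_id.fun_pow k).fun_mul hg)).fun_pow
      (k + 1)).fun_mul hgf)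
  have hlim : Tendsto f (𝓝 0) (𝓝 0) := by simpa [hf0] using hf.continuousAt.tendsto
  rw [iteratedDeriv_eq_of_eventuallyEq_linear_add_pow_mul (c := 1) hn hh]
  · have hk : k ≠ 0 := by lia
    simp only [hf0, zero_pow hk, zero_mul, add_zero, hodd.neg_one_pow]
    ring
  · filter_upwards [hfg, hlim.eventually hfg] with x hx hfx
    have hfac : f x = x * (-1 + x ^ k * g x) := by rw [hx]; ring
    rw [Function.comp_apply, hfx]
    nth_rw 2 [hfac]
    rw [mul_pow]
    nth_rw 1 [hx]
    ring

/-- let `f` be analytic near `0`, not an involution, with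
`f(x) = -x + Σ_{j≥2} aⱼ xʲ`. If `a_{2j} = 0` and the coefficient of `x^{2j+1}` of
`f ∘ f` vanishes for `j = 1, …, m`, then `a_{2j+1} = 0` for `j = 1, …, m`. -/
theorem stmt15 (U : Set ℝ) (hU : U ∈ 𝓝 (0 : ℝ)) (f : ℝ → ℝ)
    (hf : AnalyticOnNhd ℝ f U) (hf0 : f 0 = 0) (hf1 : deriv f 0 = -1)
    (hnoninv : ¬ ∀ᶠ x in 𝓝 (0 : ℝ), f (f x) = x)
    (a : ℕ → ℝ) (ha : ∀ j, a j = iteratedDeriv j f 0 / (Nat.factorial j))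
    (m : ℕ) (hm : 1 ≤ m)
    (haeven : ∀ j, 1 ≤ j → j ≤ m → a (2 * j) = 0)
    (hW : ∀ j, 1 ≤ j → j ≤ m → iteratedDeriv (2 * j + 1) (f ∘ f) 0 = 0) :
    ∀ j, 1 ≤ j → j ≤ m → a (2 * j + 1) = 0 := by
  have hf' : AnalyticAt ℝ f 0 := hf 0 (mem_of_mem_nhds hU)
  intro j
  induction j using Nat.strong_induction_on with
  | _ j ih =>
  intro hj hjm
  have hvanish : ∀ i, 2 ≤ i → i < 2 * j + 1 → iteratedDeriv i f 0 = 0 := by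
    intro i hi hij
    have hai : a i = 0 := by
      obtain ⟨k, rfl | rfl⟩ := i.even_or_odd'
      · exact haeven k (by lia) (by lia)
      · exact ih k (by lia) (by lia) (by lia)
    simpa [ha, Nat.factorial_ne_zero] using hai
  obtain ⟨g, hg, hfg⟩ := hf'.exists_eventuallyEq_sum_add_pow_mul (2 * j + 1)
  have hsum : ∀ z : ℝ, ∑ i ∈ Finset.range (2 * j + 1),
      (z ^ i / i.factorial) • iteratedDeriv i f 0 = -z := by
    intro z
    rw [Finset.sum_eq_single_of_mem 1 (by simp; lia)]
    · simp [hf1]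
    · intro i hi hi1
      obtain rfl | hi0 := eq_or_ne i 0
      · simp [hf0]
      · rw [hvanish i (by lia) (Finset.mem_range.mp hi), smul_zero]
  simp only [hsum] at hfg
  simp only [smul_eq_mul] at hfg
  have hcomp := iteratedDeriv_comp_self_of_eventuallyEq_neg_add_pow_mul (by lia)
    (odd_two_mul_add_one j) hf' hf0 hg hfg
  have hg0 : g 0 = 0 := by
    simpa [hW j hj hjm, Nat.factorial_ne_zero] using hcomp.symm
  rw [ha, iteratedDeriv_eq_of_eventuallyEq_linear_add_pow_mul (c := -1) (by lia) hg
    (by simpa using hfg), hg0]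
  simp
end
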